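/- Under Conditions 1–3, with t = [nu] for fixed u ∈ (0,1), the processes {Z_out,w([nu]) : 0 < u < 1} and {Z_out,d([nu]) : 0 < u < 1} converge jointly in finite-dimensional distributions, as n → ∞, to centered Gaussian processes that are independent of each other: for any finite set of points 0 < u_1 < … < u_k < 1, the random vector (Z_out,w([nu_1]),…,Z_out,w([nu_k]), Z_out,d([nu_1]),…,Z_out,d([nu_k])) converges in distribution to a centered multivariate Gaussian vector whose covariance matrix is the limit of the corresponding permutation-null covariance matrices, and in which the Z_out,w-block is independent of the Z_out,d-block. -/

import Mathlib

open scoped BigOperators Classical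

noncomputable section

namespace CPD

/-- Nodes: `n` individuals, each with `ℓ` repeated measurements. -/
abbrev Node (n ℓ : ℕ) := Fin n × Fin ℓ

/-- The (unordered) pair of individuals joined by an edge. -/
def indPair {n ℓ : ℕ} (e : Sym2 (Node n ℓ)) : Sym2 (Fin n) := Sym2.map Prod.fst e

/-- Between-individual edges of the graph `Gr`. -/
def Gout {n ℓ : ℕ} (Gr : Finset (Sym2 (Node n ℓ))) : Finset (Sym2 (Node n ℓ)) :=
  Gr.filter fun e => ¬ (indPair e).IsDiag

/-- Within-individual edges of the graph `Gr`. -/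
def Gin {n ℓ : ℕ} (Gr : Finset (Sym2 (Node n ℓ))) : Finset (Sym2 (Node n ℓ)) :=
  Gr.filter fun e => (indPair e).IsDiag

/-- `D Gr u v`: the number of edges of `Gr` between individual `u` and individual `v`
(for `u = v`, the number of within-individual edges of individual `u`). -/
def D {n ℓ : ℕ} (Gr : Finset (Sym2 (Node n ℓ))) (u v : Fin n) : ℕ :=
  (Gr.filter fun e => indPair e = s(u, v)).card

/-- `Ddeg Gr u = ∑_{v ≠ u} D Gr u v`. -/
def Ddeg {n ℓ : ℕ} (Gr : Finset (Sym2 (Node n ℓ))) (u : Fin n) : ℕ :=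
  ∑ v ∈ Finset.univ.filter fun v => v ≠ u, D Gr u v

/-- Number of between-individual edges both of whose endpoints belong to individuals whose
permuted label (in `{1, …, n}`) is `≤ t`. -/
def Rout1 {n ℓ : ℕ} (Gr : Finset (Sym2 (Node n ℓ))) (t : ℕ) (σ : Equiv.Perm (Fin n)) : ℕ :=
  ((Gout Gr).filter fun e => ∀ x ∈ e, ((σ x.1 : ℕ) + 1 ≤ t)).card

/-- Number of between-individual edges both of whose endpoints belong to individuals whose
permuted label is `> t`. -/
def Rout2 {n ℓ : ℕ} (Gr : Finset (Sym2 (Node n ℓ))) (t : ℕ) (σ : Equiv.Perm (Fin n)) : ℕ :=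
  ((Gout Gr).filter fun e => ∀ x ∈ e, (t ≤ (σ x.1 : ℕ))).card

/-- Number of within-individual edges both of whose endpoints belong to individuals whose
permuted label is `≤ t`. -/
def Rin1 {n ℓ : ℕ} (Gr : Finset (Sym2 (Node n ℓ))) (t : ℕ) (σ : Equiv.Perm (Fin n)) : ℕ :=
  ((Gin Gr).filter fun e => ∀ x ∈ e, ((σ x.1 : ℕ) + 1 ≤ t)).card

/-- Expectation under the permutation null distribution (uniform over the `n!` permutations of
the individual labels). -/
def pexp {n : ℕ} (f : Equiv.Perm (Fin n) → ℝ) : ℝ :=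
  (∑ σ : Equiv.Perm (Fin n), f σ) / (Nat.factorial n)

/-- Covariance under the permutation null distribution. -/
def pcov {n : ℕ} (f g : Equiv.Perm (Fin n) → ℝ) : ℝ :=
  pexp fun σ => (f σ - pexp f) * (g σ - pexp g)

/-- Variance under the permutation null distribution. -/
def pvar {n : ℕ} (f : Equiv.Perm (Fin n) → ℝ) : ℝ := pcov f f

/-- The weighted edge-count statistic
`R_out,w(t) = ((n−t−1)·R_out,1(t) + (t−1)·R_out,2(t))/(n−2)`. -/
def Routw {n ℓ : ℕ} (Gr : Finset (Sym2 (Node n ℓ))) (t : ℕ) (σ : Equiv.Perm (Fin n)) : ℝ :=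
  (((n : ℝ) - t - 1) * (Rout1 Gr t σ : ℝ) + ((t : ℝ) - 1) * (Rout2 Gr t σ : ℝ)) / ((n : ℝ) - 2)

/-- The difference edge-count statistic `R_out,d(t) = R_out,1(t) − R_out,2(t)`. -/
def Routd {n ℓ : ℕ} (Gr : Finset (Sym2 (Node n ℓ))) (t : ℕ) (σ : Equiv.Perm (Fin n)) : ℝ :=
  (Rout1 Gr t σ : ℝ) - (Rout2 Gr t σ : ℝ)

/-- Standardized weighted between-individual statistic `Z_out,w(t)`. -/
def Zoutw {n ℓ : ℕ} (Gr : Finset (Sym2 (Node n ℓ))) (t : ℕ) (σ : Equiv.Perm (Fin n)) : ℝ :=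
  (Routw Gr t σ - pexp (Routw Gr t)) / Real.sqrt (pvar (Routw Gr t))

/-- Standardized difference statistic `Z_out,d(t)`. -/
def Zoutd {n ℓ : ℕ} (Gr : Finset (Sym2 (Node n ℓ))) (t : ℕ) (σ : Equiv.Perm (Fin n)) : ℝ :=
  (Routd Gr t σ - pexp (Routd Gr t)) / Real.sqrt (pvar (Routd Gr t))

/-- Standardized within-individual statistic `Z_in(t)`. -/
def Zin {n ℓ : ℕ} (Gr : Finset (Sym2 (Node n ℓ))) (t : ℕ) (σ : Equiv.Perm (Fin n)) : ℝ :=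
  ((Rin1 Gr t σ : ℝ) - pexp (fun τ => (Rin1 Gr t τ : ℝ))) /
    Real.sqrt (pvar (fun τ => (Rin1 Gr t τ : ℝ)))

/-- The constant
`ϱ = (Σ_u D_uu·D_u − (2/n)|G_in||G_out|) / sqrt((Σ_u D_u² − 4|G_out|²/n)(Σ_u D_uu² − |G_in|²/n))`. -/
def varrho {n ℓ : ℕ} (Gr : Finset (Sym2 (Node n ℓ))) : ℝ :=
  ((∑ u : Fin n, (D Gr u u : ℝ) * (Ddeg Gr u : ℝ)) -
      2 / (n : ℝ) * ((Gin Gr).card : ℝ) * ((Gout Gr).card : ℝ)) /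
    Real.sqrt (((∑ u : Fin n, (Ddeg Gr u : ℝ) ^ 2) - 4 * ((Gout Gr).card : ℝ) ^ 2 / (n : ℝ)) *
      ((∑ u : Fin n, (D Gr u u : ℝ) ^ 2) - ((Gin Gr).card : ℝ) ^ 2 / (n : ℝ)))


open Asymptotics

/-- `e'` shares an individual with `e`. -/
def touches {n ℓ : ℕ} (e e' : Sym2 (Node n ℓ)) : Prop := ∃ x ∈ e', ∃ y ∈ e, x.1 = y.1

/-- The neighborhood `A_e` of an edge `e`: for a between-individual edge `e` joining individuals
`u, v`, the between-individual edges with an endpoint in `C_u ∪ C_v`; for a within-individual edge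
`e` of individual `u`, the between-individual edges with an endpoint in `C_u` together with the
within-individual edges of individual `u`. -/
def Ae {n ℓ : ℕ} (Gr : Finset (Sym2 (Node n ℓ))) (e : Sym2 (Node n ℓ)) :
    Finset (Sym2 (Node n ℓ)) :=
  if (indPair e).IsDiag then Gr.filter fun e' => touches e e'
  else (Gout Gr).filter fun e' => touches e e'

/-- `B_e = ∪_{ẽ ∈ A_e} A_ẽ`. -/
def Be {n ℓ : ℕ} (Gr : Finset (Sym2 (Node n ℓ))) (e : Sym2 (Node n ℓ)) :
    Finset (Sym2 (Node n ℓ)) :=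
  (Ae Gr e).biUnion fun e' => Ae Gr e'

/-- `a` and `b` are of the same (exact) order. -/
def SameOrder (a b : ℕ → ℝ) : Prop :=
  ∃ c C : ℝ, 0 < c ∧ ∀ᶠ n in Filter.atTop, c * b n ≤ a n ∧ a n ≤ C * b n

/-- Condition 1: `|G_out| = O(n)` and `|G_in| = O(n)` (exact order `n`). -/
def Cond1 (ℓ : ℕ) (Gr : ∀ n : ℕ, Finset (Sym2 (Node n ℓ))) : Prop :=
  SameOrder (fun n => ((Gout (Gr n)).card : ℝ)) (fun n => (n : ℝ)) ∧
  SameOrder (fun n => ((Gin (Gr n)).card : ℝ)) (fun n => (n : ℝ))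

/-- Condition 2: `Σ_u D_u² − 4|G_out|²/n = O(n)` and `Σ_u D_uu² − |G_in|²/n = O(n)`
(exact order `n`). -/
def Cond2 (ℓ : ℕ) (Gr : ∀ n : ℕ, Finset (Sym2 (Node n ℓ))) : Prop :=
  SameOrder
    (fun n => (∑ u : Fin n, (Ddeg (Gr n) u : ℝ) ^ 2) - 4 * ((Gout (Gr n)).card : ℝ) ^ 2 / (n : ℝ))
    (fun n => (n : ℝ)) ∧
  SameOrder
    (fun n => (∑ u : Fin n, (D (Gr n) u u : ℝ) ^ 2) - ((Gin (Gr n)).card : ℝ) ^ 2 / (n : ℝ))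
    (fun n => (n : ℝ))

/-- Condition 3: `Σ_{e ∈ G_out} |A_out,e|·|B_out,e| = o(n^{1.5})`. -/
def Cond3 (ℓ : ℕ) (Gr : ∀ n : ℕ, Finset (Sym2 (Node n ℓ))) : Prop :=
  (fun n : ℕ => ∑ e ∈ Gout (Gr n), ((Ae (Gr n) e).card : ℝ) * ((Be (Gr n) e).card : ℝ))
    =o[Filter.atTop] fun n : ℕ => (n : ℝ) ^ (1.5 : ℝ)

/-- A centered Gaussian measure: every continuous linear functional is distributed as a centered
one-dimensional Gaussian. -/
def IsCenteredGaussian {E : Type*} [NormedAddCommGroup E] [NormedSpace ℝ E] [MeasurableSpace E]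
    (μ : MeasureTheory.Measure E) : Prop :=
  ∀ L : E →L[ℝ] ℝ, ∃ v : NNReal, μ.map L = ProbabilityTheory.gaussianReal 0 v

section Independence

open Finset

variable {ι α 𝕜 : Type*} [Fintype ι] [DecidableEq ι] [Fintype α] [Nonempty α] [RCLike 𝕜]

/-- Functions of disjoint sets of coordinates are uncorrelated under the uniform distribution. -/
lemma expect_mul_of_disjoint {F G : (ι → α) → 𝕜} {S T : Set ι}
    (hF : DependsOn F S) (hG : DependsOn G T) (h : Disjoint S T) :
    𝔼 x, F x * G x = (𝔼 x, F x) * 𝔼 x, G x := by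
  let e : ((ι → α) × (ι → α)) ≃ ((ι → α) × (ι → α)) :=
    { toFun := fun p => (fun i => if i ∈ S then p.1 i else p.2 i,
        fun i => if i ∈ S then p.2 i else p.1 i)
      invFun := fun p => (fun i => if i ∈ S then p.1 i else p.2 i,
        fun i => if i ∈ S then p.2 i else p.1 i)
      left_inv := fun p => by ext i <;> by_cases hi : i ∈ S <;> simp [hi]
      right_inv := fun p => by ext i <;> by_cases hi : i ∈ S <;> simp [hi] }
  have key : 𝔼 p : (ι → α) × (ι → α), F p.1 * G p.2
      = 𝔼 p : (ι → α) × (ι → α), F p.1 * G p.1 := by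
    refine Fintype.expect_equiv e _ _ fun p => ?_
    rw [hF (x := p.1) (y := (e p).1) (fun i hi => by simp [e, hi]),
      hG (x := p.2) (y := (e p).1) (fun i hi => by
        simp [e, Set.disjoint_right.1 h hi])]
  rw [← univ_product_univ, expect_product, expect_product] at key
  rw [Fintype.expect_mul_expect, key]
  refine Finset.expect_congr rfl fun x _ => ?_
  exact (Fintype.expect_const _).symm

lemma dependsOn_sum {ι α J 𝕜 : Type*} [AddCommMonoid 𝕜] {I : Finset J} {F : J → (ι → α) → 𝕜}
    {S : Set ι} (h : ∀ j ∈ I, DependsOn (F j) S) : DependsOn (fun x => ∑ j ∈ I, F j x) S :=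
  fun _ _ hxy => Finset.sum_congr rfl fun j hj => h j hj hxy

end Independence

section LocalDependence

open Finset Complex

/-- Second-order remainder in the Stein-type expansion of the exponential. -/
lemma norm_exp_expansion_le (w s t : ℝ) :
    ‖cexp (w * I) - cexp ((w - s : ℝ) * I) - I * s * cexp ((w - t : ℝ) * I)‖
      ≤ 2 * s ^ 2 + |s| * |t| := by
  have e1 : ∀ x : ℝ, ‖cexp (x * I)‖ = 1 := Complex.norm_exp_ofReal_mul_I
  have h1 : ‖cexp (w * I) - cexp ((w - s : ℝ) * I) - I * s * cexp (w * I)‖ ≤ 2 * s ^ 2 := by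
    have : cexp (w * I) - cexp ((w - s : ℝ) * I) - I * s * cexp (w * I)
        = - cexp (w * I) * (cexp (((-s : ℝ) : ℂ) * I) - 1 - ((-s : ℝ) : ℂ) * I) := by
      have : cexp ((w - s : ℝ) * I) = cexp (w * I) * cexp (((-s : ℝ) : ℂ) * I) := by
        rw [← Complex.exp_add]; congr 1; push_cast; ring
      rw [this]; push_cast; ring
    rw [this, norm_mul, norm_neg, e1, one_mul]
    by_cases hs : |s| ≤ 1
    · have := Complex.norm_exp_sub_one_sub_id_le (x := ((-s : ℝ) : ℂ) * I) (by simpa using hs)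
      refine le_trans (b := s ^ 2) (by simpa using this) (by nlinarith [sq_nonneg s])
    · push Not at hs
      have hb : ‖cexp (((-s : ℝ) : ℂ) * I) - 1‖ ≤ |s| := by
        have := Real.norm_exp_I_mul_ofReal_sub_one_le (x := -s)
        rw [mul_comm] at this
        simpa using this
      calc _ ≤ ‖cexp (((-s : ℝ) : ℂ) * I) - 1‖ + ‖((-s : ℝ) : ℂ) * I‖ := norm_sub_le _ _
        _ ≤ |s| + |s| := by gcongr; simp
        _ ≤ _ := by nlinarith [sq_abs s]
  have h2 : ‖I * s * cexp (w * I) - I * s * cexp ((w - t : ℝ) * I)‖ ≤ |s| * |t| := by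
    have : I * s * cexp (w * I) - I * s * cexp ((w - t : ℝ) * I)
        = I * s * cexp ((w - t : ℝ) * I) * (cexp (I * t) - 1) := by
      have : cexp (w * I) = cexp ((w - t : ℝ) * I) * cexp (I * t) := by
        rw [← Complex.exp_add]; congr 1; push_cast; ring
      rw [this]; ring
    rw [this, norm_mul, norm_mul, norm_mul, e1]
    have := Real.norm_exp_I_mul_ofReal_sub_one_le (x := t)
    simp only [norm_I, Complex.norm_real, Real.norm_eq_abs, one_mul, mul_one] at this ⊢
    gcongr
  calc _ = ‖(cexp (w * I) - cexp ((w - s : ℝ) * I) - I * s * cexp (w * I))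
      + (I * s * cexp (w * I) - I * s * cexp ((w - t : ℝ) * I))‖ := by congr 1; ring
    _ ≤ _ := (norm_add_le _ _).trans (add_le_add h1 h2)

lemma norm_sub_exp_le_of_deriv {φ φ' : ℝ → ℂ} {v K : ℝ} (hv : 0 ≤ v)
    (hφ : ∀ l, HasDerivAt φ (φ' l) l) (h0 : φ 0 = 1)
    (h : ∀ l ∈ Set.Icc (0 : ℝ) 1, ‖φ' l + l * v * φ l‖ ≤ K) :
    ‖φ 1 - cexp (-(v : ℂ) / 2)‖ ≤ K := by
  have hK : 0 ≤ K := (norm_nonneg _).trans (h 0 (by simp))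
  have hd : ∀ l : ℝ, HasDerivAt (fun l : ℝ => φ l * cexp ((l : ℂ) ^ 2 * v / 2))
      ((φ' l + l * v * φ l) * cexp ((l : ℂ) ^ 2 * v / 2)) l := by
    intro l
    have h1 : HasDerivAt (fun l : ℝ => ((l : ℂ) ^ 2 * v / 2 : ℂ)) (l * v : ℂ) l := by
      have := (((hasDerivAt_id (l : ℂ)).pow 2).mul_const ((v : ℂ) / 2)).comp_ofReal
      convert this using 1
      · ext x; simp; ring
      · simp; ring
    exact ((hφ l).mul h1.cexp).congr_deriv (by ring)
  have hmv := norm_image_sub_le_of_norm_deriv_le_segment_01'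
    (f := fun l : ℝ => φ l * cexp ((l : ℂ) ^ 2 * v / 2)) (C := K * Real.exp (v / 2))
    (fun l _ => (hd l).hasDerivWithinAt) (fun l hl => by
      rw [norm_mul, Complex.norm_exp]
      have hl' : ((l : ℂ) ^ 2 * v / 2).re = l ^ 2 * v / 2 := by norm_cast
      rw [hl']
      have : l ^ 2 ≤ 1 := by nlinarith [hl.1, hl.2]
      gcongr
      · exact h l ⟨hl.1, hl.2.le⟩
      · nlinarith)
  have e : φ 1 - cexp (-(v : ℂ) / 2)
      = (φ 1 * cexp ((v : ℂ) / 2) - 1) * cexp (-(v : ℂ) / 2) := by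
    rw [sub_mul, mul_assoc, ← Complex.exp_add]; simp [neg_div]
  rw [e, norm_mul, Complex.norm_exp]
  simp only [ofReal_one, one_pow, one_mul, h0, ofReal_zero] at hmv
  have : (-(v : ℂ) / 2).re = -(v / 2) := by norm_cast; ring
  rw [this]
  calc _ ≤ (K * Real.exp (v / 2)) * Real.exp (-(v / 2)) := by
        gcongr; simpa using hmv
    _ = K := by rw [mul_assoc, ← Real.exp_add]; simp

variable {ι α J : Type*} [Fintype ι] [DecidableEq ι] [Fintype α] [Nonempty α]

lemma norm_expect_le {Ω : Type*} [Fintype Ω] (f : Ω → ℂ) : ‖𝔼 x, f x‖ ≤ 𝔼 x, ‖f x‖ := by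
  rw [Fintype.expect_eq_sum_div_card, Fintype.expect_eq_sum_div_card, norm_div]
  simp only [RCLike.norm_natCast]
  gcongr
  exact norm_sum_le _ _

lemma ofReal_expect {Ω : Type*} [Fintype Ω] (f : Ω → ℝ) :
    ((𝔼 x, f x : ℝ) : ℂ) = 𝔼 x, (f x : ℂ) := by
  simp [Fintype.expect_eq_sum_div_card]

lemma hasDerivAt_expect_exp {Ω : Type*} [Fintype Ω] (W : Ω → ℝ) (l : ℝ) :
    HasDerivAt (fun l : ℝ => 𝔼 x, cexp ((l * W x : ℝ) * I))
      (𝔼 x, (W x * I) * cexp ((l * W x : ℝ) * I)) l := by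
  simp_rw [Fintype.expect_eq_sum_div_card]
  refine HasDerivAt.div_const (HasDerivAt.fun_sum fun x _ => ?_) _
  have h1 : HasDerivAt (fun l : ℝ => ((l * W x : ℝ) : ℂ) * I) (W x * I) l := by
    have := ((hasDerivAt_id l).mul_const (W x)).ofReal_comp.mul_const I
    simpa using this
  exact h1.cexp.congr_deriv (by ring)

/-- A quantitative central limit theorem, in terms of characteristic functions, for sums of
bounded locally dependent variables on a finite product space. -/
lemma norm_expect_exp_sub_le (T : Finset J) (X : J → (ι → α) → ℝ) (S : J → Set ι) (M : J → ℝ)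
    (A B : J → Finset J)
    (hdep : ∀ i ∈ T, DependsOn (X i) (S i)) (hM : ∀ i ∈ T, ∀ x, |X i x| ≤ M i)
    (h0 : ∀ i ∈ T, 𝔼 x, X i x = 0)
    (hA : ∀ i, A i = T.filter fun j => ¬ Disjoint (S i) (S j))
    (hB : ∀ i, B i = T.filter fun j => ∃ k ∈ A i, ¬ Disjoint (S k) (S j)) :
    ‖(𝔼 x, cexp ((∑ i ∈ T, X i x : ℝ) * I))
        - cexp (-((𝔼 x, (∑ i ∈ T, X i x) ^ 2 : ℝ) : ℂ) / 2)‖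
      ≤ 4 * ∑ i ∈ T, M i * (∑ j ∈ A i, M j) * ∑ k ∈ B i, M k := by
  have hAT : ∀ i, A i ⊆ T := fun i => by rw [hA]; exact filter_subset _ _
  have hBT : ∀ i, B i ⊆ T := fun i => by rw [hB]; exact filter_subset _ _
  have hAB : ∀ i, A i ⊆ B i := fun i j hj => by
    rw [hB, mem_filter]
    refine ⟨hAT i hj, j, hj, ?_⟩
    rw [hA, mem_filter] at hj
    intro h
    exact hj.2 (by simp at h; simp [h])
  have hM0 : ∀ i ∈ T, 0 ≤ M i := fun i hi =>
    (abs_nonneg _).trans (hM i hi (Classical.arbitrary _))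
  set W : (ι → α) → ℝ := fun x => ∑ i ∈ T, X i x with hW
  set XA : J → (ι → α) → ℝ := fun i x => ∑ j ∈ A i, X j x with hXA
  set XB : J → (ι → α) → ℝ := fun i x => ∑ j ∈ B i, X j x with hXB
  have hWA : ∀ i, (fun x => W x - XA i x) = fun x => ∑ j ∈ T \ A i, X j x := fun i => by
    ext x; rw [hW, hXA]; simp only; rw [← sum_sdiff (hAT i)]; ring
  have hWB : ∀ i, (fun x => W x - XB i x) = fun x => ∑ j ∈ T \ B i, X j x := fun i => by
    ext x; rw [hW, hXB]; simp only; rw [← sum_sdiff (hBT i)]; ring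
  have dA : ∀ i, DependsOn (fun x => W x - XA i x) (S i)ᶜ := fun i => by
    rw [hWA]
    refine dependsOn_sum fun j hj => ?_
    rw [mem_sdiff, hA, mem_filter, not_and, not_not] at hj
    exact (hdep j hj.1).mono (hj.2 hj.1).symm.subset_compl_right
  have dB : ∀ i, ∀ k ∈ A i, DependsOn (fun x => W x - XB i x) (S k)ᶜ := fun i k hk => by
    rw [hWB]
    refine dependsOn_sum fun j hj => ?_
    rw [mem_sdiff, hB, mem_filter, not_and] at hj
    have := hj.2 hj.1
    push Not at this
    exact (hdep j hj.1).mono (this k hk).symm.subset_compl_right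
  have bA : ∀ i x, |XA i x| ≤ ∑ j ∈ A i, M j := fun i x =>
    (abs_sum_le_sum_abs _ _).trans (sum_le_sum fun j hj => hM j (hAT i hj) x)
  have bB : ∀ i x, |XB i x| ≤ ∑ j ∈ B i, M j := fun i x =>
    (abs_sum_le_sum_abs _ _).trans (sum_le_sum fun j hj => hM j (hBT i hj) x)
  have hvar : 𝔼 x, W x ^ 2 = ∑ i ∈ T, 𝔼 x, X i x * XA i x := by
    have : ∀ x, W x ^ 2 = ∑ i ∈ T, (X i x * XA i x + X i x * (W x - XA i x)) := fun x => by
      rw [sq]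
      conv_lhs => rw [hW]
      simp only
      rw [sum_mul]
      exact sum_congr rfl fun i _ => by ring
    simp_rw [this]
    rw [expect_sum_comm]
    refine sum_congr rfl fun i hi => ?_
    rw [expect_add_distrib, expect_mul_of_disjoint (hdep i hi) (dA i) disjoint_compl_right, h0 i hi]
    simp
  set φ : ℝ → ℂ := fun l => 𝔼 x, cexp ((l * W x : ℝ) * I) with hφ
  have step : ∀ l : ℝ, ∀ i ∈ T,
      ‖(𝔼 x, (X i x : ℂ) * cexp ((l * W x : ℝ) * I))
        - I * l * ((𝔼 x, X i x * XA i x : ℝ) : ℂ) * φ l‖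
      ≤ 4 * l ^ 2 * (M i * (∑ j ∈ A i, M j) * ∑ k ∈ B i, M k) := by
    intro l i hi
    set a := ∑ j ∈ A i, M j
    set b := ∑ k ∈ B i, M k
    have ha0 : 0 ≤ a := sum_nonneg fun j hj => hM0 j (hAT i hj)
    have hab : a ≤ b := sum_le_sum_of_subset_of_nonneg (hAB i) fun j hj _ => hM0 j (hBT i hj)
    have t1 : 𝔼 x, (X i x : ℂ) * cexp ((l * W x - l * XA i x : ℝ) * I) = 0 := by
      have dl : DependsOn (fun x => (X i x : ℂ)) (S i) := fun x y h => by
        simp only [hdep i hi h]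
      have dr : DependsOn (fun x => cexp ((l * W x - l * XA i x : ℝ) * I)) (S i)ᶜ :=
        fun x y h => by
          have := dA i h
          simp only [← mul_sub] at this ⊢
          rw [this]
      rw [expect_mul_of_disjoint dl dr disjoint_compl_right, ← ofReal_expect, h0 i hi]
      simp
    have t2 : 𝔼 x, ((X i x * XA i x : ℝ) : ℂ) * cexp ((l * W x - l * XB i x : ℝ) * I)
        = ((𝔼 x, X i x * XA i x : ℝ) : ℂ) * 𝔼 x, cexp ((l * W x - l * XB i x : ℝ) * I) := by
      have dl : DependsOn (fun x => ((X i x * XA i x : ℝ) : ℂ)) (⋃ k ∈ A i, S k) := by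
        intro x y h
        rcases (A i).eq_empty_or_nonempty with he | ⟨k, hk⟩
        · simp [hXA, he]
        · have hii : i ∈ A i := by
            rw [hA, mem_filter] at hk ⊢
            exact ⟨hi, fun h' => hk.2 (by simp at h'; simp [h'])⟩
          have hk' : ∀ k ∈ A i, X k x = X k y := fun k hk =>
            hdep k (hAT i hk) fun c hc => h c (Set.mem_biUnion hk hc)
          simp only [hXA]
          rw [hk' i hii, sum_congr rfl hk']
      have dr : DependsOn (fun x => cexp ((l * W x - l * XB i x : ℝ) * I))
          (⋃ k ∈ A i, S k)ᶜ := by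
        intro x y h
        have : W x - XB i x = W y - XB i y := by
          rw [congrFun (hWB i) x, congrFun (hWB i) y]
          refine sum_congr rfl fun j hj => ?_
          rw [mem_sdiff, hB, mem_filter, not_and] at hj
          have hj' := hj.2 hj.1
          push Not at hj'
          refine hdep j hj.1 fun c hc => h c ?_
          simp only [Set.mem_compl_iff, Set.mem_iUnion, not_exists]
          exact fun k hk hck => Set.disjoint_left.1 (hj' k hk) hck hc
        simp only [← mul_sub]
        rw [this]
      rw [expect_mul_of_disjoint dl dr disjoint_compl_right, ofReal_expect]
    have t3 : ‖(𝔼 x, cexp ((l * W x - l * XB i x : ℝ) * I)) - φ l‖ ≤ |l| * b := by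
      rw [hφ]
      simp only
      rw [← expect_sub_distrib]
      refine (norm_expect_le _).trans (expect_le univ_nonempty fun x _ => ?_)
      have : cexp ((l * W x - l * XB i x : ℝ) * I) - cexp ((l * W x : ℝ) * I)
          = cexp ((l * W x : ℝ) * I) * (cexp (I * (-(l * XB i x) : ℝ)) - 1) := by
        rw [mul_sub, ← Complex.exp_add]; push_cast; ring_nf
      rw [this, norm_mul, Complex.norm_exp_ofReal_mul_I, one_mul]
      refine Real.norm_exp_I_mul_ofReal_sub_one_le.trans ?_
      rw [norm_neg, Real.norm_eq_abs, abs_mul]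
      gcongr
      exact bB i x
    have t4 : |𝔼 x, X i x * XA i x| ≤ M i * a :=
      (abs_expect_le _ _).trans (expect_le univ_nonempty fun x _ => by
        rw [abs_mul]; exact mul_le_mul (hM i hi x) (bA i x) (abs_nonneg _) (hM0 i hi))
    have e : (𝔼 x, (X i x : ℂ) * cexp ((l * W x : ℝ) * I))
        - I * l * ((𝔼 x, X i x * XA i x : ℝ) : ℂ) * φ l
        = (𝔼 x, (X i x : ℂ) * (cexp ((l * W x : ℝ) * I) - cexp ((l * W x - l * XA i x : ℝ) * I)
            - I * (l * XA i x : ℝ) * cexp ((l * W x - l * XB i x : ℝ) * I)))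
          + I * l * ((𝔼 x, X i x * XA i x : ℝ) : ℂ)
            * ((𝔼 x, cexp ((l * W x - l * XB i x : ℝ) * I)) - φ l) := by
      have : ∀ x, (X i x : ℂ) * (cexp ((l * W x : ℝ) * I) - cexp ((l * W x - l * XA i x : ℝ) * I)
            - I * (l * XA i x : ℝ) * cexp ((l * W x - l * XB i x : ℝ) * I))
          = (X i x : ℂ) * cexp ((l * W x : ℝ) * I)
            - (X i x : ℂ) * cexp ((l * W x - l * XA i x : ℝ) * I)
            - I * l * (((X i x * XA i x : ℝ) : ℂ) * cexp ((l * W x - l * XB i x : ℝ) * I)) :=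
        fun x => by push_cast; ring
      simp_rw [this]
      rw [expect_sub_distrib, expect_sub_distrib, t1, ← mul_expect, t2]
      ring
    rw [e]
    have n1 : ‖𝔼 x, (X i x : ℂ) * (cexp ((l * W x : ℝ) * I)
          - cexp ((l * W x - l * XA i x : ℝ) * I)
          - I * (l * XA i x : ℝ) * cexp ((l * W x - l * XB i x : ℝ) * I))‖
        ≤ M i * (2 * (|l| * a) ^ 2 + |l| * a * (|l| * b)) := by
      refine (norm_expect_le _).trans (expect_le univ_nonempty fun x _ => ?_)
      rw [norm_mul, Complex.norm_real, Real.norm_eq_abs]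
      refine mul_le_mul (hM i hi x) ((norm_exp_expansion_le _ _ _).trans ?_) (norm_nonneg _)
        (hM0 i hi)
      rw [← sq_abs (l * XA i x), abs_mul, abs_mul]
      have := bA i x
      have := bB i x
      gcongr
    have n2 : ‖I * l * ((𝔼 x, X i x * XA i x : ℝ) : ℂ)
            * ((𝔼 x, cexp ((l * W x - l * XB i x : ℝ) * I)) - φ l)‖
        ≤ |l| * (M i * a) * (|l| * b) := by
      rw [norm_mul, norm_mul, norm_mul, norm_I, one_mul, Complex.norm_real, Complex.norm_real,
        Real.norm_eq_abs, Real.norm_eq_abs]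
      have := mul_nonneg (hM0 i hi) ha0
      gcongr
    refine (norm_add_le _ _).trans ((add_le_add n1 n2).trans ?_)
    have h5 : a * a ≤ a * b := mul_le_mul_of_nonneg_left hab ha0
    have h6 : 0 ≤ M i * l ^ 2 := mul_nonneg (hM0 i hi) (sq_nonneg _)
    have h7 : |l| * |l| = l ^ 2 := by rw [← sq, sq_abs]
    calc _ = (|l| * |l|) * M i * (2 * (a * a) + 2 * (a * b)) := by ring
      _ ≤ (|l| * |l|) * M i * (2 * (a * b) + 2 * (a * b)) := by
        rw [h7]
        exact mul_le_mul_of_nonneg_left (by linarith) (by linarith)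
      _ = _ := by rw [h7]; ring
  have hv : 0 ≤ 𝔼 x, W x ^ 2 := expect_nonneg fun x _ => sq_nonneg _
  have main := norm_sub_exp_le_of_deriv (φ := φ) (v := 𝔼 x, W x ^ 2)
    (K := 4 * ∑ i ∈ T, M i * (∑ j ∈ A i, M j) * ∑ k ∈ B i, M k) hv
    (fun l => hasDerivAt_expect_exp W l) (by simp [hφ]) (fun l hl => by
      have e : (𝔼 x, (W x * I) * cexp ((l * W x : ℝ) * I)) + l * ((𝔼 x, W x ^ 2 : ℝ) : ℂ) * φ l
          = I * ∑ i ∈ T, ((𝔼 x, (X i x : ℂ) * cexp ((l * W x : ℝ) * I))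
            - I * l * ((𝔼 x, X i x * XA i x : ℝ) : ℂ) * φ l) := by
        have e1 : 𝔼 x, (W x * I) * cexp ((l * W x : ℝ) * I)
            = I * ∑ i ∈ T, 𝔼 x, (X i x : ℂ) * cexp ((l * W x : ℝ) * I) := by
          rw [← expect_sum_comm, mul_expect]
          refine expect_congr rfl fun x _ => ?_
          rw [← sum_mul, ← ofReal_sum]
          ring
        rw [hvar, sum_sub_distrib, mul_sub, e1, ← sum_mul, ← mul_sum, ofReal_sum]
        linear_combination ((l : ℂ) * φ l *
          ∑ i ∈ T, ((𝔼 x, X i x * XA i x : ℝ) : ℂ)) * I_mul_I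
      rw [e, norm_mul, norm_I, one_mul, mul_sum]
      refine norm_sum_le_of_le _ fun i hi => (step l i hi).trans ?_
      have hl2 : l ^ 2 ≤ 1 := by nlinarith [hl.1, hl.2]
      have : 0 ≤ M i * (∑ j ∈ A i, M j) * ∑ k ∈ B i, M k :=
        mul_nonneg (mul_nonneg (hM0 i hi) (sum_nonneg fun j hj => hM0 j (hAT i hj)))
          (sum_nonneg fun j hj => hM0 j (hBT i hj))
      nlinarith)
  simpa only [hφ, one_mul] using main

end LocalDependence

section Comparison

open Finset

/-- Two arrays of bounded variables, jointly exchangeable, the first one summing to zero, the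
second one behaving like independent centered variables, and close to each other in mean. -/
structure ExchCoupling {n : ℕ} {Ω : Type*} [Fintype Ω] (y z : Fin n → Ω → ℝ) (ε : ℝ) : Prop where
  exch : ∀ ρ : Equiv.Perm (Fin n), ∃ e : Ω ≃ Ω, ∀ u ω, y u (e ω) = y (ρ u) ω ∧ z u (e ω) = z (ρ u) ω
  abs_y_le : ∀ u ω, |y u ω| ≤ 1
  abs_z_le : ∀ u ω, |z u ω| ≤ 1
  sum_y : ∀ ω, ∑ u, y u ω = 0
  close : ∀ u, 𝔼 ω, |y u ω - z u ω| ≤ ε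
  indep : ∀ u v w x, u ≠ v → u ≠ w → u ≠ x → 𝔼 ω, z u ω * z v ω * (z w ω * z x ω) = 0

variable {n : ℕ} {Ω : Type*} [Fintype Ω] {y z : Fin n → Ω → ℝ} {ε : ℝ}

lemma expect_mul_sum_le (f g : Ω → ℝ) {K : ℝ} (hg : ∀ ω, |g ω| ≤ K) :
    |𝔼 ω, f ω * g ω| ≤ (𝔼 ω, |f ω|) * K := by
  refine (abs_expect_le _ _).trans ?_
  rw [expect_mul]
  exact expect_le_expect fun ω _ => by
    rw [abs_mul]; exact mul_le_mul_of_nonneg_left (hg ω) (abs_nonneg _)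

lemma ExchCoupling.linear (h : ExchCoupling y z ε) (c : Fin n → ℝ) (hc : ∑ u, c u = 0) :
    𝔼 ω, (∑ u, c u * (y u ω - z u ω)) ^ 2 ≤ 4 * ε * ∑ u, c u ^ 2 := by
  set E : Fin n → Fin n → ℝ := fun u v => 𝔼 ω, (y u ω - z u ω) * (y v ω - z v ω) with hE
  have bE : ∀ u v, |E u v| ≤ 2 * ε := fun u v => by
    refine (expect_mul_sum_le _ _ (K := 2) fun ω => ?_).trans ?_
    · have := h.abs_y_le v ω
      have := h.abs_z_le v ω
      exact (abs_sub _ _).trans (by linarith)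
    · have := h.close u
      linarith
  have hsw : ∀ u v v', v ≠ u → v' ≠ u → E u v = E u v' := fun u v v' hv hv' => by
    obtain ⟨e, he⟩ := h.exch (Equiv.swap v v')
    refine Fintype.expect_equiv e.symm _ _ fun ω => ?_
    have h1 := he u (e.symm ω)
    have h2 := he v' (e.symm ω)
    rw [Equiv.apply_symm_apply, Equiv.swap_apply_of_ne_of_ne hv.symm hv'.symm] at h1
    rw [Equiv.apply_symm_apply, Equiv.swap_apply_right] at h2
    have h3 := he v (e.symm ω)
    rw [Equiv.apply_symm_apply, Equiv.swap_apply_left] at h3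
    rw [h1.1, h1.2, h3.1, h3.2]
  have hsq : 𝔼 ω, (∑ u, c u * (y u ω - z u ω)) ^ 2 = ∑ u, c u * ∑ v, c v * E u v := by
    have : ∀ ω, (∑ u, c u * (y u ω - z u ω)) ^ 2
        = ∑ u, ∑ v, c u * (c v * ((y u ω - z u ω) * (y v ω - z v ω))) := fun ω => by
      rw [sq, sum_mul_sum]
      exact sum_congr rfl fun u _ => sum_congr rfl fun v _ => by ring
    simp_rw [this, expect_sum_comm, ← mul_expect, ← mul_sum]
    rfl
  rw [hsq, mul_sum]
  refine sum_le_sum fun u _ => ?_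
  obtain ⟨m, hm, hm'⟩ : ∃ m, |m| ≤ 2 * ε ∧ ∀ v, v ≠ u → E u v = m := by
    by_cases hex : ∃ v, v ≠ u
    · obtain ⟨v, hv⟩ := hex
      exact ⟨E u v, bE u v, fun v' hv' => hsw u v' v hv' hv⟩
    · push Not at hex
      exact ⟨0, by simpa using (abs_nonneg _).trans (bE u u), fun v hv => absurd (hex v) hv⟩
  have : ∑ v, c v * E u v = c u * (E u u - m) := by
    have h1 : ∑ v, c v * (E u v - m) = c u * (E u u - m) := by
      refine sum_eq_single u (fun v _ hv => by rw [hm' v hv]; ring) (by simp)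
    rw [← h1]
    simp_rw [mul_sub]
    rw [sum_sub_distrib, ← sum_mul, hc]
    ring
  rw [this]
  have h1 := abs_le.1 (bE u u)
  have h2 := abs_le.1 hm
  nlinarith [sq_nonneg (c u)]

lemma abs_mul_four_sub_le {a b c d a' b' c' d' : ℝ} (hb : |b| ≤ 1) (hc : |c| ≤ 1)
    (hd : |d| ≤ 1) (ha' : |a'| ≤ 1) (hb' : |b'| ≤ 1) (hc' : |c'| ≤ 1) :
    |a * b * (c * d) - a' * b' * (c' * d')| ≤ |a - a'| + |b - b'| + |c - c'| + |d - d'| := by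
  have e : a * b * (c * d) - a' * b' * (c' * d')
      = (a - a') * (b * c * d) + (b - b') * (a' * c * d) + (c - c') * (a' * b' * d)
        + (d - d') * (a' * b' * c') := by ring
  have key : ∀ p q r s : ℝ, |q| ≤ 1 → |r| ≤ 1 → |s| ≤ 1 → |p * (q * r * s)| ≤ |p| := by
    intro p q r s hq hr hs
    rw [abs_mul, abs_mul, abs_mul]
    exact mul_le_of_le_one_right (abs_nonneg _)
      (mul_le_one₀ (mul_le_one₀ hq (abs_nonneg _) hr) (abs_nonneg _) hs)
  rw [e]
  refine (abs_add_le _ _).trans (add_le_add ((abs_add_le _ _).trans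
    (add_le_add ((abs_add_le _ _).trans (add_le_add ?_ ?_)) ?_)) ?_)
  all_goals apply key <;> assumption

lemma ExchCoupling.abs_expect_mul_le (h : ExchCoupling y z ε) {P Q R S : Fin n → Ω → ℝ}
    (hP : P = y ∨ P = z) (hQ : Q = y ∨ Q = z) (hR : R = y ∨ R = z) (hS : S = y ∨ S = z)
    {u v w x : Fin n} (h0 : 𝔼 ω, z u ω * z v ω * (z w ω * z x ω) = 0) :
    |𝔼 ω, P u ω * Q v ω * (R w ω * S x ω)| ≤ 4 * ε := by
  have ε0 : 0 ≤ ε := (expect_nonneg fun ω _ => abs_nonneg _).trans (h.close u)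
  have hc : ∀ {P : Fin n → Ω → ℝ}, P = y ∨ P = z → ∀ u, 𝔼 ω, |P u ω - z u ω| ≤ ε := by
    rintro P (rfl | rfl) u
    · exact h.close u
    · simpa using ε0
  have hb : ∀ {P : Fin n → Ω → ℝ}, P = y ∨ P = z → ∀ u ω, |P u ω| ≤ 1 := by
    rintro P (rfl | rfl) u
    · exact h.abs_y_le u
    · exact h.abs_z_le u
  have : 𝔼 ω, P u ω * Q v ω * (R w ω * S x ω)
      = 𝔼 ω, (P u ω * Q v ω * (R w ω * S x ω) - z u ω * z v ω * (z w ω * z x ω)) := by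
    rw [expect_sub_distrib, h0, sub_zero]
  rw [this]
  calc _ ≤ 𝔼 ω, (|P u ω - z u ω| + |Q v ω - z v ω| + |R w ω - z w ω| + |S x ω - z x ω|) :=
        (abs_expect_le _ _).trans (expect_le_expect fun ω _ =>
          abs_mul_four_sub_le (hb hQ _ _) (hb hR _ _) (hb hS _ _) (h.abs_z_le _ _)
            (h.abs_z_le _ _) (h.abs_z_le _ _))
    _ ≤ ε + ε + ε + ε := by
        simp only [expect_add_distrib]
        exact add_le_add (add_le_add (add_le_add (hc hP u) (hc hQ v)) (hc hR w)) (hc hS x)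
    _ = _ := by ring

lemma ExchCoupling.abs_expect_distinct_le (h : ExchCoupling y z ε) {P Q : Fin n → Ω → ℝ}
    (hP : P = y ∨ P = z) (hQ : Q = y ∨ Q = z) (hn : 3 < n)
    {u v w x : Fin n} (huv : u ≠ v) (huw : u ≠ w) (hux : u ≠ x) (hvw : v ≠ w) (hvx : v ≠ x)
    (hwx : w ≠ x) :
    |𝔼 ω, y u ω * y v ω * (P w ω * Q x ω)| ≤ 12 * ε / (n - 3) := by
  set E : Fin n → ℝ := fun a => 𝔼 ω, y a ω * y v ω * (P w ω * Q x ω) with hE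
  have hn' : (0 : ℝ) < n - 3 := by
    have : (3 : ℝ) < n := by exact_mod_cast hn
    linarith
  have hsum : ∑ a, E a = 0 := by
    rw [hE]
    simp only
    rw [← expect_sum_comm]
    refine expect_eq_zero fun ω _ => ?_
    rw [← sum_mul, ← sum_mul, h.sum_y]
    ring
  have hsw : ∀ a, a ≠ v → a ≠ w → a ≠ x → E a = E u := fun a hav haw hax => by
    obtain ⟨e, he⟩ := h.exch (Equiv.swap a u)
    refine (Fintype.expect_equiv e _ _ fun ω => ?_).symm
    have fix : ∀ b, b ≠ a → b ≠ u → y b (e ω) = y b ω ∧ z b (e ω) = z b ω := fun b h1 h2 => by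
      have := he b ω
      rwa [Equiv.swap_apply_of_ne_of_ne h1 h2] at this
    have fix' : ∀ {P : Fin n → Ω → ℝ}, P = y ∨ P = z → ∀ b, b ≠ a → b ≠ u →
        P b (e ω) = P b ω := by
      rintro P (rfl | rfl) b h1 h2
      · exact (fix b h1 h2).1
      · exact (fix b h1 h2).2
    have ha := (he a ω).1
    rw [Equiv.swap_apply_left] at ha
    rw [ha, (fix v hav.symm huv.symm).1, fix' hP w haw.symm huw.symm,
      fix' hQ x hax.symm hux.symm]
  have hsplit : (n - 3 : ℝ) * E u = -(E v + E w + E x) := by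
    have h1 : ∑ a, (E a - E u) = (E v - E u) + (E w - E u) + (E x - E u) := by
      rw [← sum_subset (subset_univ {v, w, x})]
      · rw [sum_insert, sum_insert, sum_singleton]
        · ring
        · simpa using hwx
        · simpa using ⟨hvw, hvx⟩
      · intro a _ ha
        simp only [mem_insert, mem_singleton, not_or] at ha
        rw [hsw a ha.1 ha.2.1 ha.2.2, sub_self]
    rw [sum_sub_distrib, hsum] at h1
    simp at h1
    linarith
  have hswap : ∀ a b c d : Fin n, 𝔼 ω, z a ω * z b ω * (z c ω * z d ω)
      = 𝔼 ω, z b ω * z a ω * (z c ω * z d ω) := fun a b c d =>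
    expect_congr rfl fun ω _ => by ring
  have hv := h.abs_expect_mul_le (Or.inl rfl) (Or.inl rfl) hP hQ (u := v) (v := v) (w := w)
    (x := x) (by
      rw [← h.indep w v v x hvw.symm hvw.symm hwx]
      exact expect_congr rfl fun ω _ => by ring)
  have hw := h.abs_expect_mul_le (Or.inl rfl) (Or.inl rfl) hP hQ (u := w) (v := v) (w := w)
    (x := x) (by rw [hswap]; exact h.indep _ _ _ _ hvw hvw hvx)
  have hx := h.abs_expect_mul_le (Or.inl rfl) (Or.inl rfl) hP hQ (u := x) (v := v) (w := w)
    (x := x) (by rw [hswap]; exact h.indep _ _ _ _ hvx hvw hvx)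
  change |E u| ≤ _
  rw [le_div_iff₀ hn', ← abs_of_pos hn', ← abs_mul, mul_comm, hsplit, abs_neg]
  refine (abs_add_three _ _ _).trans ?_
  change |E v| ≤ _ at hv
  change |E w| ≤ _ at hw
  change |E x| ≤ _ at hx
  linarith

lemma ExchCoupling.quadratic (h : ExchCoupling y z ε) (hn : 3 < n) (a : Fin n → Fin n → ℝ)
    (ha : ∀ u v, 0 ≤ a u v) (ha0 : ∀ u, a u u = 0) (hsymm : ∀ u v, a u v = a v u) :
    𝔼 ω, (∑ u, ∑ v, a u v * (y u ω * y v ω - z u ω * z v ω)) ^ 2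
      ≤ 16 * ε * (∑ u, (∑ v, a u v) ^ 2) + 36 * ε / (n - 3) * (∑ u, ∑ v, a u v) ^ 2 := by
  set η : Fin n → Fin n → Ω → ℝ := fun u v ω => y u ω * y v ω - z u ω * z v ω with hη
  have hn' : (0 : ℝ) < n - 3 := by
    have : (3 : ℝ) < n := by exact_mod_cast hn
    linarith
  have ε0 : 0 ≤ ε := (expect_nonneg fun ω _ => abs_nonneg _).trans (h.close ⟨0, by omega⟩)
  have one : ∀ (f : Fin n → Ω → ℝ), (∀ u ω, |f u ω| ≤ 1) → ∀ u v ω, |f u ω * f v ω| ≤ 1 :=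
    fun f hf u v ω => by
      rw [abs_mul]; exact mul_le_one₀ (hf u ω) (abs_nonneg _) (hf v ω)
  have bη : ∀ u v ω, |η u v ω| ≤ 2 := fun u v ω => by
    have h1 := one y h.abs_y_le u v ω
    have h2 := one z h.abs_z_le u v ω
    exact (abs_sub _ _).trans (by linarith)
  have mη : ∀ u v, 𝔼 ω, |η u v ω| ≤ 2 * ε := fun u v => by
    calc _ ≤ 𝔼 ω, (|y u ω - z u ω| + |y v ω - z v ω|) := expect_le_expect fun ω _ => by
          have e : η u v ω = (y u ω - z u ω) * y v ω + (y v ω - z v ω) * z u ω := by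
            simp only [hη]; ring
          rw [e]
          refine (abs_add_le _ _).trans ?_
          rw [abs_mul, abs_mul]
          exact add_le_add (mul_le_of_le_one_right (abs_nonneg _) (h.abs_y_le _ _))
            (mul_le_of_le_one_right (abs_nonneg _) (h.abs_z_le _ _))
      _ ≤ ε + ε := by
          rw [expect_add_distrib]; exact add_le_add (h.close u) (h.close v)
      _ = _ := by ring
  have crude : ∀ u v w x, 𝔼 ω, η u v ω * η w x ω ≤ 4 * ε := fun u v w x => by
    refine (le_abs_self _).trans ((expect_mul_sum_le _ _ (bη w x)).trans ?_)
    have := mη u v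
    linarith
  have fine : ∀ u v w x, u ≠ v → u ≠ w → u ≠ x → v ≠ w → v ≠ x → w ≠ x →
      𝔼 ω, η u v ω * η w x ω ≤ 36 * ε / (n - 3) := by
    intro u v w x huv huw hux hvw hvx hwx
    have e : 𝔼 ω, η u v ω * η w x ω
        = (𝔼 ω, y u ω * y v ω * (y w ω * y x ω)) - (𝔼 ω, y u ω * y v ω * (z w ω * z x ω))
          - (𝔼 ω, y w ω * y x ω * (z u ω * z v ω))
          + 𝔼 ω, z u ω * z v ω * (z w ω * z x ω) := by
      rw [← expect_sub_distrib, ← expect_sub_distrib, ← expect_add_distrib]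
      exact expect_congr rfl fun ω _ => by simp only [hη]; ring
    rw [e, h.indep u v w x huv huw hux]
    have h1 := abs_le.1 (h.abs_expect_distinct_le (P := y) (Q := y) (Or.inl rfl) (Or.inl rfl) hn
      huv huw hux hvw hvx hwx)
    have h2 := abs_le.1 (h.abs_expect_distinct_le (P := z) (Q := z) (Or.inr rfl) (Or.inr rfl) hn
      huv huw hux hvw hvx hwx)
    have h3 := abs_le.1 (h.abs_expect_distinct_le (P := z) (Q := z) (Or.inr rfl) (Or.inr rfl) hn
      hwx huw.symm hvw.symm hux.symm hvx.symm huv)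
    have : 36 * ε / (n - 3) = 3 * (12 * ε / (n - 3)) := by ring
    rw [this]
    linarith
  have hsq : 𝔼 ω, (∑ u, ∑ v, a u v * η u v ω) ^ 2
      = ∑ u, ∑ v, ∑ w, ∑ x, a u v * a w x * 𝔼 ω, η u v ω * η w x ω := by
    have : ∀ ω, (∑ u, ∑ v, a u v * η u v ω) ^ 2
        = ∑ u, ∑ v, ∑ w, ∑ x, a u v * a w x * (η u v ω * η w x ω) := fun ω => by
      rw [sq, sum_mul]
      refine sum_congr rfl fun u _ => ?_
      rw [sum_mul]
      refine sum_congr rfl fun v _ => ?_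
      rw [mul_sum]
      refine sum_congr rfl fun w _ => ?_
      rw [mul_sum]
      exact sum_congr rfl fun x _ => by ring
    simp_rw [this, expect_sum_comm, ← mul_expect]
  rw [hsq]
  have bound : ∀ u v w x, a u v * a w x * (𝔼 ω, η u v ω * η w x ω)
      ≤ 4 * ε * ((if u = w then a u v * a w x else 0) + (if u = x then a u v * a w x else 0)
        + (if v = w then a u v * a w x else 0) + (if v = x then a u v * a w x else 0))
        + 36 * ε / (n - 3) * (a u v * a w x) := by
    intro u v w x
    have hnn : 0 ≤ a u v * a w x := mul_nonneg (ha _ _) (ha _ _)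
    have hq : 0 ≤ 36 * ε / (n - 3) := by positivity
    have i1 : ∀ p : Prop, 0 ≤ (if p then a u v * a w x else 0) := fun p => by
      split_ifs <;> simp [hnn]
    by_cases huv : u = v
    · subst huv; simp [ha0]
    by_cases hwx : w = x
    · subst hwx; simp [ha0]
    have hcr := mul_le_mul_of_nonneg_left (crude u v w x) hnn
    have hqq := mul_nonneg hq hnn
    by_cases hd : u = w ∨ u = x ∨ v = w ∨ v = x
    · have : a u v * a w x ≤ ((if u = w then a u v * a w x else 0)
          + (if u = x then a u v * a w x else 0)
          + (if v = w then a u v * a w x else 0) + (if v = x then a u v * a w x else 0)) := by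
        have := i1 (u = w)
        have := i1 (u = x)
        have := i1 (v = w)
        have := i1 (v = x)
        rcases hd with h | h | h | h <;> simp only [h, if_true] at * <;> linarith
      have := mul_le_mul_of_nonneg_left this (mul_nonneg zero_le_four ε0)
      linarith
    · push Not at hd
      have := mul_le_mul_of_nonneg_left
        (fine u v w x huv hd.1 hd.2.1 hd.2.2.1 hd.2.2.2 hwx) hnn
      simp only [hd.1, hd.2.1, hd.2.2.1, hd.2.2.2, if_false]
      linarith
  refine (sum_le_sum fun u _ => sum_le_sum fun v _ => sum_le_sum fun w _ => sum_le_sum fun x _ =>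
    bound u v w x).trans (le_of_eq ?_)
  have row : ∀ u, ∑ v, a v u = ∑ v, a u v := fun u => sum_congr rfl fun v _ => hsymm v u
  have s1 : ∑ u, ∑ v, ∑ w, ∑ x, (if u = w then a u v * a w x else 0)
      = ∑ u, (∑ v, a u v) ^ 2 := by
    refine sum_congr rfl fun u _ => ?_
    rw [sq, sum_mul]
    refine sum_congr rfl fun v _ => ?_
    rw [mul_sum, sum_comm]
    simp
  have s2 : ∑ u, ∑ v, ∑ w, ∑ x, (if u = x then a u v * a w x else 0)
      = ∑ u, (∑ v, a u v) ^ 2 := by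
    refine sum_congr rfl fun u _ => ?_
    rw [sq, sum_mul]
    refine sum_congr rfl fun v _ => ?_
    rw [mul_sum]
    simp [hsymm u]
  have s3 : ∑ u, ∑ v, ∑ w, ∑ x, (if v = w then a u v * a w x else 0)
      = ∑ u, (∑ v, a u v) ^ 2 := by
    rw [← s1, sum_comm]
    refine sum_congr rfl fun v _ => sum_congr rfl fun u _ => ?_
    simp only [hsymm u v]
  have s4 : ∑ u, ∑ v, ∑ w, ∑ x, (if v = x then a u v * a w x else 0)
      = ∑ u, (∑ v, a u v) ^ 2 := by
    rw [← s2, sum_comm]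
    refine sum_congr rfl fun v _ => sum_congr rfl fun u _ => ?_
    simp only [hsymm u v]
  have s5 : ∑ u, ∑ v, ∑ w, ∑ x, a u v * a w x = (∑ u, ∑ v, a u v) ^ 2 := by
    rw [sq, sum_mul]
    refine sum_congr rfl fun u _ => ?_
    rw [sum_mul]
    refine sum_congr rfl fun v _ => ?_
    simp only [mul_sum]
  simp only [sum_add_distrib, ← mul_sum] at s1 s2 s3 s4 s5 ⊢
  rw [s1, s2, s3, s4, s5]
  ring

end Comparison

section Coupling

open Finset

/-- A list of independent uniform labels together with an independent uniform permutation. -/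
abbrev Coup (n : ℕ) := (Fin n → Fin n) × Equiv.Perm (Fin n)

/-- The independent labels, rearranged to be in the order prescribed by the permutation. -/
def label {n : ℕ} (ω : Coup n) (u : Fin n) : Fin n := ω.1 (Tuple.sort ω.1 (ω.2 u))

/-- Centered indicator that the label `a` is among the first `t` ones. -/
def zc {n : ℕ} (t : ℕ) (a : Fin n) : ℝ := (if (a : ℕ) < t then 1 else 0) - (t : ℝ) / n

variable {n : ℕ}

lemma expect_comp_eval {ι α M : Type*} [Fintype ι] [DecidableEq ι] [Fintype α] [Nonempty α] [AddCommGroup M]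
    [Module ℚ≥0 M] (f : α → M) (i : ι) : 𝔼 g : ι → α, f (g i) = 𝔼 a, f a := by
  rw [Fintype.expect_equiv (Equiv.funSplitAt i α) (fun g => f (g i)) (fun p => f p.1)
    (fun g => rfl), ← univ_product_univ, expect_product]
  exact expect_congr rfl fun a _ => expect_const univ_nonempty (f a)

lemma expect_coup_snd [NeZero n] {M : Type*} [AddCommGroup M] [Module ℚ≥0 M]
    (F : Equiv.Perm (Fin n) → M) : 𝔼 ω : Coup n, F ω.2 = 𝔼 τ, F τ := by
  rw [← univ_product_univ, expect_product]
  exact expect_const univ_nonempty (𝔼 τ, F τ)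

lemma expect_label [NeZero n] {M : Type*} [AddCommGroup M] [Module ℚ≥0 M]
    (F : (Fin n → Fin n) → M) : 𝔼 ω : Coup n, F (label ω) = 𝔼 g, F g := by
  rw [← univ_product_univ, expect_product]
  have h1 : ∀ g : Fin n → Fin n, 𝔼 τ : Equiv.Perm (Fin n), F (label (g, τ))
      = 𝔼 τ : Equiv.Perm (Fin n), F (g ∘ τ) := fun g =>
    Fintype.expect_equiv (Equiv.mulLeft (Tuple.sort g)) _ _ fun τ => rfl
  have h2 : ∀ τ : Equiv.Perm (Fin n), 𝔼 g : Fin n → Fin n, F (g ∘ τ) = 𝔼 g, F g := fun τ =>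
    Fintype.expect_equiv (τ.symm.arrowCongr (Equiv.refl _)) _ _ fun g => rfl
  simp only [h1]
  rw [expect_comm]
  simp only [h2]
  exact expect_const univ_nonempty (𝔼 g, F g)

lemma pexp_eq_expect (f : Equiv.Perm (Fin n) → ℝ) : pexp f = 𝔼 τ, f τ := by
  rw [Fintype.expect_eq_sum_div_card, Fintype.card_perm, Fintype.card_fin, pexp]

lemma sum_zc [NeZero n] {t : ℕ} (ht : t ≤ n) : ∑ a : Fin n, zc t a = 0 := by
  have hn : (n : ℝ) ≠ 0 := by exact_mod_cast NeZero.ne n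
  simp only [zc, sum_sub_distrib, sum_boole, Fin.card_filter_val_lt, sum_const, card_univ,
    Fintype.card_fin, nsmul_eq_mul, min_eq_right ht]
  field_simp
  simp

lemma expect_zc [NeZero n] {t : ℕ} (ht : t ≤ n) : 𝔼 a : Fin n, zc t a = 0 := by
  rw [Fintype.expect_eq_sum_div_card, sum_zc ht, zero_div]

lemma expect_zc_mul_zc [NeZero n] {s t : ℕ} (hs : s ≤ n) (ht : t ≤ n) :
    𝔼 a : Fin n, zc s a * zc t a = min ((s : ℝ) / n) (t / n) - (s : ℝ) / n * (t / n) := by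
  have hn : (n : ℝ) ≠ 0 := by exact_mod_cast NeZero.ne n
  have e : ∀ a : Fin n, zc s a * zc t a
      = (if (a : ℕ) < min s t then 1 else 0) - (t : ℝ) / n * zc s a - (s : ℝ) / n * zc t a
        - (s : ℝ) / n * (t / n) := fun a => by
    simp only [zc, lt_min_iff]
    by_cases h1 : (a : ℕ) < s <;> by_cases h2 : (a : ℕ) < t <;> simp [h1, h2] <;> ring
  rw [Fintype.expect_eq_sum_div_card, sum_congr rfl fun a _ => e a]
  simp only [sum_sub_distrib, ← mul_sum, sum_zc hs, sum_zc ht, sum_boole, Fin.card_filter_val_lt,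
    sum_const, card_univ, Fintype.card_fin, nsmul_eq_mul]
  rw [min_eq_right (by omega : min s t ≤ n), min_div_div_right (by positivity)]
  push_cast
  field_simp
  ring

lemma abs_zc_le {t : ℕ} (ht : t ≤ n) (a : Fin n) : |zc t a| ≤ 1 := by
  have h0 : (0 : ℝ) ≤ (t : ℝ) / n := by positivity
  have h1 : (t : ℝ) / n ≤ 1 := div_le_one_of_le₀ (by exact_mod_cast ht) (by positivity)
  rw [abs_le, zc]
  split_ifs <;> constructor <;> linarith

lemma dependsOn_zc (t : ℕ) (u : Fin n) :
    DependsOn (fun g : Fin n → Fin n => zc t (g u)) {u} := fun _ _ h => by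
  simp [h u rfl]

lemma expect_zc_mul_eq_zero [NeZero n] {t : ℕ} (ht : t ≤ n) {u : Fin n} {G : (Fin n → Fin n) → ℝ}
    {S : Set (Fin n)} (hG : DependsOn G S) (hu : u ∉ S) : 𝔼 g, zc t (g u) * G g = 0 := by
  rw [expect_mul_of_disjoint (dependsOn_zc t u) hG (by simpa using hu), expect_comp_eval,
    expect_zc ht, zero_mul]

lemma sum_abs_zc_sub [NeZero n] {t : ℕ} (ht : t ≤ n) {g : Fin n → Fin n} (hg : Monotone g) :
    ∑ j, |zc t j - zc t (g j)| = |∑ j, zc t (g j)| := by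
  have hsum : |∑ j, zc t (g j)| = |∑ j, (zc t j - zc t (g j))| := by
    rw [sum_sub_distrib, sum_zc ht, zero_sub, abs_neg]
  rw [hsum]
  have key : (∀ j : Fin n, 0 ≤ zc t j - zc t (g j)) ∨ ∀ j : Fin n, zc t j - zc t (g j) ≤ 0 := by
    by_contra! h
    obtain ⟨⟨i, hi⟩, j, hj⟩ := h
    simp only [zc] at hi hj
    have hi1 : t ≤ (i : ℕ) ∧ (g i : ℕ) < t := by
      by_contra hcon
      split_ifs at hi <;> first | omega | linarith
    have hj1 : (j : ℕ) < t ∧ t ≤ (g j : ℕ) := by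
      by_contra hcon
      split_ifs at hj <;> first | omega | linarith
    have : g j ≤ g i := hg (Fin.le_def.2 (by omega))
    have := Fin.le_def.1 this
    omega
  rcases key with h | h
  · rw [abs_of_nonneg (sum_nonneg fun j _ => h j)]
    exact sum_congr rfl fun j _ => abs_of_nonneg (h j)
  · rw [abs_of_nonpos (sum_nonpos fun j _ => h j), ← sum_neg_distrib]
    exact sum_congr rfl fun j _ => abs_of_nonpos (h j)

lemma expect_abs_sum_zc_le [NeZero n] {t : ℕ} (ht : t ≤ n) :
    𝔼 g : Fin n → Fin n, |∑ u, zc t (g u)| ≤ Real.sqrt n := by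
  refine Real.le_sqrt_of_sq_le ?_
  have h1 := expect_mul_sq_le_sq_mul_sq (univ : Finset (Fin n → Fin n))
    (fun g => |∑ u, zc t (g u)|) (fun _ => 1)
  simp only [mul_one, one_pow, sq_abs] at h1
  rw [Fintype.expect_const, mul_one] at h1
  refine h1.trans ?_
  have h2 : ∀ g : Fin n → Fin n, (∑ u, zc t (g u)) ^ 2
      = ∑ u, ∑ v, zc t (g u) * zc t (g v) := fun g => by rw [sq, sum_mul_sum]
  simp_rw [h2, expect_sum_comm]
  have h3 : ∀ u v : Fin n, 𝔼 g : Fin n → Fin n, zc t (g u) * zc t (g v) ≤ if u = v then 1 else 0 := by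
    intro u v
    split_ifs with h
    · subst h
      refine (expect_le_expect fun g _ => ?_).trans (Fintype.expect_const (1 : ℝ)).le
      have := abs_zc_le ht (g u)
      nlinarith [abs_mul_abs_self (zc t (g u)), abs_nonneg (zc t (g u))]
    · exact (expect_zc_mul_eq_zero ht (dependsOn_zc t v) (by simpa using h)).le
  refine (sum_le_sum fun u _ => sum_le_sum fun v _ => h3 u v).trans ?_
  simp

lemma exchCoupling [NeZero n] {t : ℕ} (ht : t ≤ n) :
    ExchCoupling (Ω := Coup n) (fun u ω => zc t (ω.2 u)) (fun u ω => zc t (label ω u))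
      (1 / Real.sqrt n) := by
  have hexch : ∀ ρ : Equiv.Perm (Fin n), ∃ e : Coup n ≃ Coup n, ∀ u ω,
      zc t ((e ω).2 u) = zc t (ω.2 (ρ u)) ∧ zc t (label (e ω) u) = zc t (label ω (ρ u)) :=
    fun ρ => ⟨(Equiv.refl _).prodCongr (Equiv.mulRight ρ), fun u ω => ⟨rfl, rfl⟩⟩
  refine ⟨hexch, fun u ω => abs_zc_le ht _, fun u ω => abs_zc_le ht _, fun ω => ?_, fun u => ?_,
    fun u v w x hv hw hx => ?_⟩
  · rw [Equiv.sum_comp ω.2 (fun a => zc t a), sum_zc ht]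
  · have hconst : ∀ v, 𝔼 ω : Coup n, |zc t (ω.2 v) - zc t (label ω v)|
        = 𝔼 ω : Coup n, |zc t (ω.2 u) - zc t (label ω u)| := fun v => by
      obtain ⟨e, he⟩ := hexch (Equiv.swap u v)
      refine (Fintype.expect_equiv e _ _ fun ω => ?_)
      rw [(he u ω).1, (he u ω).2, Equiv.swap_apply_left]
    have hsum : ∑ v, 𝔼 ω : Coup n, |zc t (ω.2 v) - zc t (label ω v)|
        = 𝔼 g : Fin n → Fin n, |∑ v, zc t (g v)| := by
      rw [← expect_sum_comm, ← expect_label]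
      refine expect_congr rfl fun ω _ => ?_
      have h := sum_abs_zc_sub ht (Tuple.monotone_sort ω.1)
      have e1 : ∑ v, zc t (label ω v) = ∑ j, zc t ((ω.1 ∘ Tuple.sort ω.1) j) :=
        Equiv.sum_comp ω.2 (fun j => zc t ((ω.1 ∘ Tuple.sort ω.1) j))
      rw [e1, ← h]
      exact Equiv.sum_comp ω.2 (fun j => |zc t j - zc t ((ω.1 ∘ Tuple.sort ω.1) j)|)
    simp only [hconst, sum_const, card_univ, Fintype.card_fin, nsmul_eq_mul] at hsum
    have hle := hsum.le.trans (expect_abs_sum_zc_le ht)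
    have hn : (0 : ℝ) < n := by exact_mod_cast Nat.pos_of_ne_zero (NeZero.ne n)
    rw [le_div_iff₀ (Real.sqrt_pos.2 hn)]
    have hs := Real.mul_self_sqrt hn.le
    have hp := Real.sqrt_pos.2 hn
    refine le_of_mul_le_mul_left ?_ hp
    calc _ = Real.sqrt n * Real.sqrt n * 𝔼 ω : Coup n, |zc t (ω.2 u) - zc t (label ω u)| := by ring
      _ ≤ _ := by rw [hs, mul_one]; exact hle
  · rw [expect_label (fun g => zc t (g u) * zc t (g v) * (zc t (g w) * zc t (g x)))]
    have hd : DependsOn (fun g : Fin n → Fin n => zc t (g v) * (zc t (g w) * zc t (g x)))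
        {v, w, x} := fun _ _ h => by
      simp [h v (by simp), h w (by simp), h x (by simp)]
    simp_rw [mul_assoc]
    exact expect_zc_mul_eq_zero ht hd (by simp [hv, hw, hx])

end Coupling

section Graph

open Finset

variable {n ℓ : ℕ} (Gr : Finset (Sym2 (Node n ℓ)))

/-- Number of between-individual edges joining `u` and `v` (zero on the diagonal). -/
def adj (u v : Fin n) : ℝ := (((Gout Gr).filter fun e => indPair e = s(u, v)).card : ℝ)

/-- Centered degree of an individual. -/
def cdeg (u : Fin n) : ℝ := (Ddeg Gr u : ℝ) - 2 * ((Gout Gr).card : ℝ) / n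

variable {Gr}

lemma adj_nonneg (u v : Fin n) : 0 ≤ adj Gr u v := Nat.cast_nonneg _

lemma adj_symm (u v : Fin n) : adj Gr u v = adj Gr v u := by rw [adj, adj, Sym2.eq_swap]

lemma adj_self (u : Fin n) : adj Gr u u = 0 := by
  rw [adj, Nat.cast_eq_zero, card_eq_zero, filter_eq_empty_iff]
  intro e he h
  rw [Gout, mem_filter, h] at he
  exact he.2 (by simp)

lemma adj_le_sq (u v : Fin n) : adj Gr u v ≤ adj Gr u v ^ 2 := by
  rw [adj]
  exact_mod_cast Nat.le_self_pow two_ne_zero _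

lemma cast_Ddeg (u : Fin n) : (Ddeg Gr u : ℝ) = ∑ v, adj Gr u v := by
  rw [Ddeg, sum_filter, Nat.cast_sum]
  refine sum_congr rfl fun v _ => ?_
  split_ifs with h
  · rw [D, adj, Gout, filter_filter]
    congr 2
    refine filter_congr fun e _ => ⟨fun he => ⟨?_, he⟩, fun he => he.2⟩
    rw [he]
    simpa using fun h' => h h'.symm
  · rw [not_not] at h
    rw [h, adj_self, Nat.cast_zero]

lemma sum_adj_mul_eq (f : Fin n → Fin n → ℝ) : ∑ u, ∑ v, adj Gr u v * f u v
    = ∑ e ∈ Gout Gr, ∑ u, ∑ v, if indPair e = s(u, v) then f u v else 0 := by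
  rw [sum_comm]
  conv_rhs => rw [sum_comm]; enter [2, u]; rw [sum_comm]
  rw [sum_comm]
  refine sum_congr rfl fun u _ => sum_congr rfl fun v _ => ?_
  rw [← sum_filter, sum_const, nsmul_eq_mul, adj]

lemma sum_ite_pair_eq {p : Sym2 (Fin n)} (hp : ¬ p.IsDiag) (F : Sym2 (Fin n) → ℝ) :
    (∑ u, ∑ v, if p = s(u, v) then F s(u, v) else 0) = 2 * F p := by
  induction p using Sym2.ind with
  | _ x y =>
    have hxy : x ≠ y := by simpa using hp
    have h : ∀ u v, (if s(x, y) = s(u, v) then F s(u, v) else 0)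
        = (if x = u then if y = v then F s(x, y) else 0 else 0)
          + (if y = u then if x = v then F s(x, y) else 0 else 0) := by
      intro u v
      simp only [Sym2.eq_iff]
      by_cases h1 : x = u
      · subst h1
        by_cases h2 : y = v
        · subst h2; simp [hxy.symm]
        · simp [h2, hxy.symm]
      · by_cases h3 : y = u
        · subst h3
          by_cases h4 : x = v
          · subst h4; simp [h1, Sym2.eq_swap]
          · simp [h1, h4]
        · simp [h1, h3]
    simp only [h, sum_add_distrib]
    simp
    ring

lemma sum_adj_mul_pair (F : Sym2 (Fin n) → ℝ) : ∑ u, ∑ v, adj Gr u v * F s(u, v)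
    = 2 * ∑ e ∈ Gout Gr, F (indPair e) := by
  rw [sum_adj_mul_eq (fun u v => F s(u, v)), mul_sum]
  exact sum_congr rfl fun e he => sum_ite_pair_eq (mem_filter.1 he).2 F

lemma sum_sum_adj : ∑ u, ∑ v, adj Gr u v = 2 * ((Gout Gr).card : ℝ) := by
  simpa using sum_adj_mul_pair (Gr := Gr) fun _ => 1

lemma sum_Ddeg : ∑ u, (Ddeg Gr u : ℝ) = 2 * ((Gout Gr).card : ℝ) := by
  simp only [cast_Ddeg, sum_sum_adj]

lemma card_le_sum_adj_sq : ((Gout Gr).card : ℝ) ≤ (∑ u, ∑ v, adj Gr u v ^ 2) / 2 := by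
  have := sum_le_sum fun u (_ : u ∈ univ) => sum_le_sum fun v (_ : v ∈ univ) =>
    adj_le_sq (Gr := Gr) u v
  rw [sum_sum_adj] at this
  linarith

lemma sum_cdeg [NeZero n] : ∑ u, cdeg Gr u = 0 := by
  have hn : (n : ℝ) ≠ 0 := by exact_mod_cast NeZero.ne n
  simp only [cdeg, sum_sub_distrib, sum_Ddeg, sum_const, card_univ, Fintype.card_fin, nsmul_eq_mul]
  field_simp
  ring

lemma sum_cdeg_sq [NeZero n] : ∑ u, cdeg Gr u ^ 2
    = (∑ u : Fin n, (Ddeg Gr u : ℝ) ^ 2) - 4 * ((Gout Gr).card : ℝ) ^ 2 / n := by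
  have hn : (n : ℝ) ≠ 0 := by exact_mod_cast NeZero.ne n
  have e : ∀ u, cdeg Gr u ^ 2 = (Ddeg Gr u : ℝ) ^ 2
      - 4 * ((Gout Gr).card : ℝ) / n * (Ddeg Gr u : ℝ) + 4 * ((Gout Gr).card : ℝ) ^ 2 / n ^ 2 :=
    fun u => by rw [cdeg]; field_simp; ring
  simp only [e, sum_sub_distrib, sum_add_distrib, ← mul_sum, sum_Ddeg, sum_const, card_univ,
    Fintype.card_fin, nsmul_eq_mul]
  field_simp
  ring

lemma forall_mem_iff_indPair (e : Sym2 (Node n ℓ)) (P : Fin n → Prop) :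
    (∀ x ∈ e, P x.1) ↔ ∀ a ∈ indPair e, P a := by
  simp only [indPair, Sym2.mem_map]
  constructor
  · rintro h a ⟨x, hx, rfl⟩; exact h x hx
  · exact fun h x hx => h x.1 ⟨x, hx, rfl⟩

lemma card_filter_forall (P : Fin n → Prop) :
    (((Gout Gr).filter fun e => ∀ x ∈ e, P x.1).card : ℝ)
      = (∑ u, ∑ v, adj Gr u v * ((if P u then 1 else 0) * if P v then 1 else 0)) / 2 := by
  have h := sum_adj_mul_pair (Gr := Gr) fun p => if ∀ a ∈ p, P a then 1 else 0
  simp only [← forall_mem_iff_indPair, sum_boole] at h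
  rw [eq_div_iff two_ne_zero, mul_comm, ← h]
  refine sum_congr rfl fun u _ => sum_congr rfl fun v _ => ?_
  by_cases h1 : P u <;> by_cases h2 : P v <;> simp [h1, h2]

lemma sum_adj_mul_left (f : Fin n → ℝ) :
    ∑ u, ∑ v, adj Gr u v * f u = ∑ u, (Ddeg Gr u : ℝ) * f u := by
  simp only [← sum_mul, cast_Ddeg]

lemma sum_adj_mul_right (f : Fin n → ℝ) :
    ∑ u, ∑ v, adj Gr u v * f v = ∑ u, (Ddeg Gr u : ℝ) * f u := by
  rw [sum_comm, ← sum_adj_mul_left]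
  exact sum_congr rfl fun u _ => sum_congr rfl fun v _ => by rw [adj_symm]

lemma sum_Ddeg_mul_zc [NeZero n] {t : ℕ} (ht : t ≤ n) (σ : Equiv.Perm (Fin n)) :
    ∑ u, (Ddeg Gr u : ℝ) * zc t (σ u) = ∑ u, cdeg Gr u * zc t (σ u) := by
  simp only [cdeg, sub_mul, sum_sub_distrib, ← mul_sum]
  rw [Equiv.sum_comp σ (fun a => zc t a), sum_zc ht, mul_zero, sub_zero]

lemma cast_Rout1 (t : ℕ) (σ : Equiv.Perm (Fin n)) : (Rout1 Gr t σ : ℝ)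
    = (∑ u, ∑ v, adj Gr u v * ((zc t (σ u) + (t : ℝ) / n) * (zc t (σ v) + (t : ℝ) / n))) / 2 := by
  refine (Eq.trans (by rw [Rout1]; congr!)
    (card_filter_forall (Gr := Gr) fun a => (σ a : ℕ) + 1 ≤ t)).trans ?_
  congr 1
  refine sum_congr rfl fun u _ => sum_congr rfl fun v _ => ?_
  simp only [zc, sub_add_cancel, Nat.succ_le_iff]

lemma cast_Rout2 (t : ℕ) (σ : Equiv.Perm (Fin n)) : (Rout2 Gr t σ : ℝ)
    = (∑ u, ∑ v, adj Gr u v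
        * ((1 - (zc t (σ u) + (t : ℝ) / n)) * (1 - (zc t (σ v) + (t : ℝ) / n)))) / 2 := by
  refine (Eq.trans (by rw [Rout2]; congr!)
    (card_filter_forall (Gr := Gr) fun a => t ≤ (σ a : ℕ))).trans ?_
  congr 1
  refine sum_congr rfl fun u _ => sum_congr rfl fun v _ => ?_
  simp only [zc, sub_add_cancel, ← not_lt]
  by_cases h1 : (σ u : ℕ) < t <;> by_cases h2 : (σ v : ℕ) < t <;> simp [h1, h2]

lemma exists_Routd_eq [NeZero n] {t : ℕ} (ht : t ≤ n) :
    ∃ C : ℝ, ∀ σ, Routd Gr t σ = C + ∑ u, cdeg Gr u * zc t (σ u) := by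
  refine ⟨∑ u, ∑ v, adj Gr u v * ((t : ℝ) / n - 1 / 2), fun σ => ?_⟩
  have e : ∑ u, cdeg Gr u * zc t (σ u)
      = ((∑ u, ∑ v, adj Gr u v * zc t (σ u)) + ∑ u, ∑ v, adj Gr u v * zc t (σ v)) / 2 := by
    rw [sum_adj_mul_left (fun u => zc t (σ u)), sum_adj_mul_right (fun u => zc t (σ u)),
      sum_Ddeg_mul_zc ht]
    ring
  rw [e, Routd, cast_Rout1, cast_Rout2, ← sub_div, ← sum_sub_distrib, ← sum_add_distrib, sum_div,
    sum_div, ← sum_add_distrib]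
  refine sum_congr rfl fun u _ => ?_
  rw [← sum_sub_distrib, ← sum_add_distrib, sum_div, sum_div, ← sum_add_distrib]
  refine sum_congr rfl fun v _ => ?_
  ring

lemma exists_Routw_eq [NeZero n] (hn : 2 < n) {t : ℕ} (ht : t ≤ n) :
    ∃ C η : ℝ, |η| ≤ 1 / ((n : ℝ) - 2) ∧ ∀ σ, Routw Gr t σ
      = C + (∑ u, ∑ v, adj Gr u v * (zc t (σ u) * zc t (σ v))) / 2
        + η * ∑ u, cdeg Gr u * zc t (σ u) := by
  have hn2 : (0 : ℝ) < n - 2 := by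
    have : (2 : ℝ) < n := by exact_mod_cast hn
    linarith
  have hn0 : (0 : ℝ) < n := by linarith
  have htn : (t : ℝ) ≤ n := by exact_mod_cast ht
  set p : ℝ := (t : ℝ) / n with hp
  set β : ℝ := ((t : ℝ) - 1) / (n - 2) with hβ
  refine ⟨∑ u, ∑ v, adj Gr u v * ((p ^ 2 - 2 * p * β + β) / 2), p - β, ?_, fun σ => ?_⟩
  · have : p - β = (n - 2 * t) / n * (1 / (n - 2)) := by rw [hp, hβ]; field_simp; ring
    rw [this, abs_mul, abs_of_pos (by positivity : 0 < 1 / ((n : ℝ) - 2))]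
    refine mul_le_of_le_one_left (by positivity) ?_
    rw [abs_le, div_le_iff₀ hn0, le_div_iff₀ hn0]
    have : (0 : ℝ) ≤ t := Nat.cast_nonneg _
    constructor <;> linarith
  · have e : ∑ u, cdeg Gr u * zc t (σ u)
        = ((∑ u, ∑ v, adj Gr u v * zc t (σ u)) + ∑ u, ∑ v, adj Gr u v * zc t (σ v)) / 2 := by
      rw [sum_adj_mul_left (fun u => zc t (σ u)), sum_adj_mul_right (fun u => zc t (σ u)),
        sum_Ddeg_mul_zc ht]
      ring
    have eR : Routw Gr t σ = (1 - β) * Rout1 Gr t σ + β * Rout2 Gr t σ := by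
      rw [Routw, hβ]; field_simp; ring
    rw [e, eR, cast_Rout1, cast_Rout2, ← hp]
    simp only [← sum_add_distrib, sum_div, mul_sum]
    refine sum_congr rfl fun u _ => ?_
    refine sum_congr rfl fun v _ => ?_
    ring

end Graph

section Neighborhoods

open Finset

variable {n ℓ : ℕ} {Gr : Finset (Sym2 (Node n ℓ))}

lemma touches_iff (e e' : Sym2 (Node n ℓ)) :
    touches e e' ↔ ∃ a ∈ indPair e, a ∈ indPair e' := by
  simp only [touches, indPair, Sym2.mem_map]
  constructor
  · rintro ⟨x, hx, y, hy, h⟩; exact ⟨y.1, ⟨y, hy, rfl⟩, x, hx, h⟩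
  · rintro ⟨_, ⟨y, hy, rfl⟩, x, hx, h⟩; exact ⟨x, hx, y, hy, h⟩

lemma mem_Ae {e e' : Sym2 (Node n ℓ)} (he : e ∈ Gout Gr) (he' : e' ∈ Gout Gr) {a : Fin n}
    (h : a ∈ indPair e) (h' : a ∈ indPair e') : e' ∈ Ae Gr e := by
  rw [Ae, if_neg (mem_filter.1 he).2, mem_filter, touches_iff]
  exact ⟨he', a, h, h'⟩

lemma Ddeg_eq_card (u : Fin n) :
    (Ddeg Gr u : ℝ) = (((Gout Gr).filter fun e => u ∈ indPair e).card : ℝ) := by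
  rw [cast_Ddeg]
  simp only [adj, ← sum_boole]
  rw [sum_comm]
  refine sum_congr rfl fun e he => ?_
  have hd := (mem_filter.1 he).2
  revert hd
  induction indPair e using Sym2.ind with
  | _ x y =>
    intro hd
    have hxy : x ≠ y := by simpa using hd
    simp only [Sym2.eq_iff, Sym2.mem_iff]
    by_cases h1 : x = u
    · subst h1; simp [hxy.symm]
    · by_cases h2 : y = u
      · subst h2; simp [h1]
      · simp [h1, h2, Ne.symm h1, Ne.symm h2]

lemma Ddeg_le_card_Ae {e : Sym2 (Node n ℓ)} (he : e ∈ Gout Gr) {u : Fin n}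
    (hu : u ∈ indPair e) : (Ddeg Gr u : ℝ) ≤ (Ae Gr e).card := by
  rw [Ddeg_eq_card]
  exact_mod_cast card_le_card fun e' he' =>
    mem_Ae he (mem_filter.1 he').1 hu (mem_filter.1 he').2

lemma sum_Ddeg_le (V : Finset (Fin n)) : ∑ x ∈ V, (Ddeg Gr x : ℝ)
    ≤ 2 * (((Gout Gr).filter fun e => ∃ x ∈ V, x ∈ indPair e).card : ℝ) := by
  simp only [Ddeg_eq_card, ← sum_boole]
  rw [sum_comm, mul_sum]
  refine sum_le_sum fun e he => ?_
  split_ifs with h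
  · rw [sum_boole, mul_one]
    have : V.filter (fun x => x ∈ indPair e) ⊆ (indPair e).toFinset := fun x hx => by
      simpa using (mem_filter.1 hx).2
    refine (Nat.cast_le.2 (card_le_card this)).trans ?_
    rw [Sym2.card_toFinset_of_not_isDiag _ (mem_filter.1 he).2]
    norm_num
  · push Not at h
    rw [sum_eq_zero fun x hx => if_neg (h x hx), mul_zero]

/-- The individuals at graph distance at most one from `u` or `v`. -/
def nbhd (Gr : Finset (Sym2 (Node n ℓ))) (u v : Fin n) : Finset (Fin n) :=
  univ.filter fun x => x = u ∨ x = v ∨ adj Gr u x ≠ 0 ∨ adj Gr v x ≠ 0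

lemma exists_edge {u v : Fin n} (h : adj Gr u v ≠ 0) : ∃ e ∈ Gout Gr, indPair e = s(u, v) := by
  rw [adj, Nat.cast_ne_zero, card_ne_zero] at h
  obtain ⟨e, he⟩ := h
  exact ⟨e, mem_filter.1 he⟩

lemma subset_Be {e : Sym2 (Node n ℓ)} (he : e ∈ Gout Gr) {u v : Fin n} (h : indPair e = s(u, v)) :
    ((Gout Gr).filter fun e' => ∃ x ∈ nbhd Gr u v, x ∈ indPair e') ⊆ Be Gr e := by
  intro e' he'
  obtain ⟨he', x, hx, hxe⟩ := mem_filter.1 he'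
  have hu : u ∈ indPair e := by simp [h]
  have hv : v ∈ indPair e := by simp [h]
  have step : ∀ a ∈ indPair e, adj Gr a x ≠ 0 → e' ∈ Be Gr e := fun a ha hax => by
    obtain ⟨e'', he'', h''⟩ := exists_edge hax
    exact mem_biUnion.2 ⟨e'', mem_Ae he he'' ha (by simp [h'']), mem_Ae he'' he' (by simp [h'']) hxe⟩
  have self : x ∈ indPair e → e' ∈ Be Gr e := fun hx =>
    mem_biUnion.2 ⟨e, mem_Ae he he hu hu, mem_Ae he he' hx hxe⟩
  rcases (mem_filter.1 hx).2 with rfl | rfl | h1 | h1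
  · exact self hu
  · exact self hv
  · exact step u hu h1
  · exact step v hv h1

lemma adj_le_Ddeg (u v : Fin n) : adj Gr u v ≤ Ddeg Gr u := by
  rw [cast_Ddeg]
  exact single_le_sum (f := fun v => adj Gr u v) (fun x _ => adj_nonneg u x) (mem_univ v)

lemma one_le_adj {u v : Fin n} (h : adj Gr u v ≠ 0) : 1 ≤ adj Gr u v := by
  rw [adj] at h ⊢
  exact_mod_cast Nat.one_le_iff_ne_zero.2 (by exact_mod_cast h)

lemma one_le_Ddeg {u v : Fin n} (h : adj Gr u v ≠ 0) : 1 ≤ (Ddeg Gr u : ℝ) :=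
  (one_le_adj h).trans (adj_le_Ddeg u v)

lemma one_le_Ddeg_of_mem_nbhd {u v x : Fin n} (h : adj Gr u v ≠ 0) (hx : x ∈ nbhd Gr u v) :
    1 ≤ (Ddeg Gr x : ℝ) := by
  rcases (mem_filter.1 hx).2 with rfl | rfl | h1 | h1
  · exact one_le_Ddeg h
  · exact one_le_Ddeg (v := u) (by rwa [adj_symm])
  · exact one_le_Ddeg (v := u) (by rwa [adj_symm])
  · exact one_le_Ddeg (v := v) (by rwa [adj_symm])

/-- Total weight of the terms meeting a set of individuals. -/
def load (Gr : Finset (Sym2 (Node n ℓ))) (c : ℝ) (V : Finset (Fin n)) : ℝ :=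
  ∑ x ∈ V, (3 * (Ddeg Gr x : ℝ) + c)

variable {c : ℝ}

lemma load_nonneg (hc : 0 ≤ c) (V : Finset (Fin n)) : 0 ≤ load Gr c V :=
  sum_nonneg fun x _ => by positivity

lemma load_mono (hc : 0 ≤ c) {V W : Finset (Fin n)} (h : V ⊆ W) : load Gr c V ≤ load Gr c W :=
  sum_le_sum_of_subset_of_nonneg h fun x _ _ => by positivity

lemma load_le (hc : 0 ≤ c) {V : Finset (Fin n)} (h : ∀ x ∈ V, 1 ≤ (Ddeg Gr x : ℝ)) :
    load Gr c V ≤ (3 + c) * ∑ x ∈ V, (Ddeg Gr x : ℝ) := by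
  rw [load, mul_sum]
  exact sum_le_sum fun x hx => by nlinarith [h x hx]

/-- Size of the summand attached to a pair of individuals. -/
def weight (Gr : Finset (Sym2 (Node n ℓ))) (c : ℝ) (p : Fin n × Fin n) : ℝ :=
  adj Gr p.1 p.2 + if p.1 = p.2 then (Ddeg Gr p.1 : ℝ) + c else 0

lemma weight_nonneg (hc : 0 ≤ c) (p : Fin n × Fin n) : 0 ≤ weight Gr c p := by
  have := adj_nonneg (Gr := Gr) p.1 p.2
  rw [weight]
  split_ifs <;> positivity

lemma sum_weight_le (hc : 0 ≤ c) (V : Finset (Fin n)) {A : Finset (Fin n × Fin n)}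
    (hA : ∀ p ∈ A, p.1 ∈ V ∨ p.2 ∈ V) : ∑ p ∈ A, weight Gr c p ≤ load Gr c V := by
  have h1 : ∑ p ∈ A, weight Gr c p ≤ ∑ p : Fin n × Fin n,
      ((if p.1 ∈ V then adj Gr p.1 p.2 else 0) + (if p.2 ∈ V then adj Gr p.1 p.2 else 0)
        + if p.1 = p.2 then (if p.1 ∈ V then (Ddeg Gr p.1 : ℝ) + c else 0) else 0) := by
    have hnn : ∀ p : Fin n × Fin n, 0 ≤ ((if p.1 ∈ V then adj Gr p.1 p.2 else 0)
        + (if p.2 ∈ V then adj Gr p.1 p.2 else 0)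
        + if p.1 = p.2 then (if p.1 ∈ V then (Ddeg Gr p.1 : ℝ) + c else 0) else 0) := fun p => by
      have := adj_nonneg (Gr := Gr) p.1 p.2
      split_ifs <;> positivity
    refine le_trans (sum_le_sum fun p hp => ?_)
      (sum_le_sum_of_subset_of_nonneg (subset_univ A) fun p _ _ => hnn p)
    have h0 := adj_nonneg (Gr := Gr) p.1 p.2
    rw [weight]
    rcases hA p hp with h | h
    · simp only [h, if_true]
      split_ifs <;> linarith
    · simp only [h, if_true]
      by_cases h2 : p.1 = p.2
      · simp only [h2, h, if_true]
        rw [h2] at h0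
        linarith
      · simp only [h2, if_false]
        split_ifs <;> linarith
  refine h1.trans (le_of_eq ?_)
  rw [← univ_product_univ, sum_product]
  simp only [sum_add_distrib]
  have e1 : ∑ u, ∑ v, (if u ∈ V then adj Gr u v else 0) = ∑ u ∈ V, (Ddeg Gr u : ℝ) := by
    simp only [cast_Ddeg]
    rw [← sum_filter_add_sum_filter_not univ (fun u => u ∈ V)]
    rw [sum_eq_zero (s := univ.filter fun u => u ∉ V) fun u hu => by
      simp [(mem_filter.1 hu).2], add_zero, filter_univ_mem]
    exact sum_congr rfl fun u hu => by simp [hu]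
  have e2 : ∑ u, ∑ v, (if v ∈ V then adj Gr u v else 0) = ∑ u ∈ V, (Ddeg Gr u : ℝ) := by
    rw [sum_comm, ← e1]
    exact sum_congr rfl fun u _ => sum_congr rfl fun v _ => by rw [adj_symm]
  rw [e1, e2]
  simp [load, sum_add_distrib, ← mul_sum]
  ring

lemma adj_mul_load_le (hc : 0 ≤ c) {e : Sym2 (Node n ℓ)} (he : e ∈ Gout Gr) {u v : Fin n}
    (h : indPair e = s(u, v)) :
    load Gr c {u, v} * load Gr c (nbhd Gr u v)
      ≤ 4 * (3 + c) ^ 2 * ((Ae Gr e).card * (Be Gr e).card) := by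
  have hadj : adj Gr u v ≠ 0 := by
    rw [adj, Nat.cast_ne_zero, card_ne_zero]
    exact ⟨e, mem_filter.2 ⟨he, h⟩⟩
  have hB : load Gr c (nbhd Gr u v) ≤ (3 + c) * (2 * (Be Gr e).card) := by
    refine (load_le hc fun x hx => one_le_Ddeg_of_mem_nbhd hadj hx).trans ?_
    refine mul_le_mul_of_nonneg_left ((sum_Ddeg_le _).trans ?_) (by positivity)
    have := card_le_card (subset_Be he h)
    have : ((((Gout Gr).filter fun e' => ∃ x ∈ nbhd Gr u v, x ∈ indPair e').card : ℕ) : ℝ)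
      ≤ (Be Gr e).card := by exact_mod_cast this
    linarith
  have hA : load Gr c {u, v} ≤ (3 + c) * (2 * (Ae Gr e).card) := by
    refine (load_le hc fun x hx => one_le_Ddeg_of_mem_nbhd hadj (v := v) (u := u) ?_).trans ?_
    · rw [nbhd, mem_filter]
      simp only [mem_insert, mem_singleton] at hx
      rcases hx with h | h <;> simp [h]
    · refine mul_le_mul_of_nonneg_left ?_ (by positivity)
      refine (sum_le_card_nsmul _ _ ((Ae Gr e).card : ℝ) fun x hx => ?_).trans ?_
      · refine Ddeg_le_card_Ae he ?_
        rw [h]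
        simpa using hx
      · rw [nsmul_eq_mul]
        refine mul_le_mul_of_nonneg_right ?_ (Nat.cast_nonneg _)
        exact_mod_cast card_le_two
  refine (mul_le_mul hA hB (load_nonneg hc _) (by positivity)).trans (le_of_eq ?_)
  ring

lemma sum_adj_mul_load_le (hc : 0 ≤ c) :
    ∑ u, ∑ v, adj Gr u v * (load Gr c {u, v} * load Gr c (nbhd Gr u v))
      ≤ 8 * (3 + c) ^ 2 * ∑ e ∈ Gout Gr, ((Ae Gr e).card : ℝ) * (Be Gr e).card := by
  rw [sum_adj_mul_eq, mul_sum]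
  refine sum_le_sum fun e he => ?_
  have h1 := sum_ite_pair_eq (mem_filter.1 he).2
    fun _ => 4 * (3 + c) ^ 2 * (((Ae Gr e).card : ℝ) * (Be Gr e).card)
  calc _ ≤ _ := sum_le_sum fun u _ => sum_le_sum fun v _ => ?_
    _ = _ := h1
    _ = _ := by ring
  split_ifs with h
  · exact adj_mul_load_le hc he h
  · exact le_rfl

lemma sum_weight_mul_load_le (hc : 0 ≤ c) :
    ∑ p : Fin n × Fin n, weight Gr c p * load Gr c {p.1, p.2} * load Gr c (nbhd Gr p.1 p.2)
      ≤ c ^ 3 * n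
        + 8 * (2 + c) * (3 + c) ^ 2 * ∑ e ∈ Gout Gr, ((Ae Gr e).card : ℝ) * (Be Gr e).card := by
  set Q : Fin n → Fin n → ℝ := fun u v => load Gr c {u, v} * load Gr c (nbhd Gr u v) with hQ
  have hQ0 : ∀ u v, 0 ≤ Q u v := fun u v => mul_nonneg (load_nonneg hc _) (load_nonneg hc _)
  have hmono : ∀ u v, Q u u ≤ Q u v := fun u v => by
    refine mul_le_mul (load_mono hc ?_) (load_mono hc ?_) (load_nonneg hc _) (load_nonneg hc _)
    · intro x hx
      simp only [mem_insert, mem_singleton, or_self] at hx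
      simp [hx]
    · intro x hx
      simp only [nbhd, mem_filter, mem_univ, true_and] at hx ⊢
      tauto
  have hdiag : ∀ u, ((Ddeg Gr u : ℝ) + c) * Q u u ≤ c ^ 3 + (1 + c) * ∑ v, adj Gr u v * Q u v := by
    intro u
    by_cases h0 : Ddeg Gr u = 0
    · have hadj : ∀ v, adj Gr u v = 0 := fun v => by
        refine le_antisymm ((adj_le_Ddeg u v).trans ?_) (adj_nonneg u v)
        rw [h0, Nat.cast_zero]
      have hn : nbhd Gr u u = {u} := by
        ext x
        simp [nbhd, hadj]
      simp only [hQ, hn, load, hadj]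
      simp [h0]
      exact le_of_eq (by ring)
    · have h1 : (1 : ℝ) ≤ Ddeg Gr u := by exact_mod_cast Nat.one_le_iff_ne_zero.2 h0
      have h2 : (Ddeg Gr u : ℝ) * Q u u ≤ ∑ v, adj Gr u v * Q u v := by
        rw [cast_Ddeg, sum_mul]
        exact sum_le_sum fun v _ => mul_le_mul_of_nonneg_left (hmono u v) (adj_nonneg u v)
      have h3 : c * Q u u ≤ c * ((Ddeg Gr u : ℝ) * Q u u) :=
        mul_le_mul_of_nonneg_left (le_mul_of_one_le_left (hQ0 u u) h1) hc
      have h4 := mul_le_mul_of_nonneg_left h2 hc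
      have : 0 ≤ c ^ 3 := by positivity
      nlinarith
  rw [← univ_product_univ, sum_product]
  have e : ∀ u v, weight Gr c (u, v) * load Gr c {u, v} * load Gr c (nbhd Gr u v)
      = adj Gr u v * Q u v + if u = v then ((Ddeg Gr u : ℝ) + c) * Q u u else 0 := fun u v => by
    rw [weight, mul_assoc, add_mul]
    congr 1
    by_cases h : u = v
    · subst h; simp [hQ]
    · simp [h]
  simp only [e, sum_add_distrib]
  simp only [sum_ite_eq, mem_univ, if_true]
  have h1 := sum_le_sum fun u (_ : u ∈ univ) => hdiag u
  simp only [sum_add_distrib, ← mul_sum, sum_const, card_univ, Fintype.card_fin,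
    nsmul_eq_mul] at h1
  have h2 := mul_le_mul_of_nonneg_left (sum_adj_mul_load_le (Gr := Gr) hc)
    (by positivity : 0 ≤ 2 + c)
  change (2 + c) * ∑ u, ∑ v, adj Gr u v * Q u v ≤ _ at h2
  nlinarith

end Neighborhoods

section IndependentLabels

open Finset Complex

variable {n ℓ : ℕ} {Gr : Finset (Sym2 (Node n ℓ))}

/-- A combination of an edge statistic and a degree statistic of a labelling. -/
def stat (Gr : Finset (Sym2 (Node n ℓ))) (Φ : Fin n → Fin n → ℝ) (φ : Fin n → ℝ)
    (g : Fin n → Fin n) : ℝ :=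
  (∑ u, ∑ v, adj Gr u v * Φ (g u) (g v)) / 2 + ∑ u, cdeg Gr u * φ (g u)

lemma norm_expect_exp_stat_sub_le [NeZero n] {Φ : Fin n → Fin n → ℝ} {φ : Fin n → ℝ} {K c : ℝ}
    (hK : 0 ≤ K) (hΦ : ∀ a b, |Φ a b| ≤ K) (hφ : ∀ a, |φ a| ≤ K)
    (hΦ0 : ∀ u v : Fin n, u ≠ v → 𝔼 g : Fin n → Fin n, Φ (g u) (g v) = 0)
    (hφ0 : 𝔼 a, φ a = 0) (hc : 2 * ((Gout Gr).card : ℝ) / n ≤ c) :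
    ‖(𝔼 g, cexp ((stat Gr Φ φ g : ℝ) * I)) - cexp (-((𝔼 g, stat Gr Φ φ g ^ 2 : ℝ) : ℂ) / 2)‖
      ≤ 4 * K ^ 3 * (c ^ 3 * n
        + 8 * (2 + c) * (3 + c) ^ 2 * ∑ e ∈ Gout Gr, ((Ae Gr e).card : ℝ) * (Be Gr e).card) := by
  have hc0 : 0 ≤ c := le_trans (by positivity) hc
  set T : Finset (Fin n × Fin n) := univ.filter fun p => adj Gr p.1 p.2 ≠ 0 ∨ p.1 = p.2 with hT
  set X : Fin n × Fin n → (Fin n → Fin n) → ℝ := fun p g =>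
    adj Gr p.1 p.2 / 2 * Φ (g p.1) (g p.2) + if p.1 = p.2 then cdeg Gr p.1 * φ (g p.1) else 0
    with hX
  set S : Fin n × Fin n → Set (Fin n) := fun p => {p.1, p.2} with hS
  have hstat : ∀ g, ∑ p ∈ T, X p g = stat Gr Φ φ g := fun g => by
    rw [sum_filter_of_ne (s := univ) (f := fun p => X p g) (fun p _ hp => by
      by_contra! h
      exact hp (by simp [hX, h.1, h.2]))]
    rw [← univ_product_univ, sum_product]
    simp only [hX, sum_add_distrib, stat, sum_ite_eq, mem_univ, if_true, sum_div]
    congr 1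
    exact sum_congr rfl fun u _ => sum_congr rfl fun v _ => by ring
  have hcd : ∀ u, |cdeg Gr u| ≤ (Ddeg Gr u : ℝ) + c := fun u => by
    rw [cdeg]
    refine (abs_sub _ _).trans ?_
    rw [Nat.abs_cast, abs_of_nonneg (by positivity)]
    linarith
  have key := norm_expect_exp_sub_le T X S (fun p => K * weight Gr c p)
    (fun p => T.filter fun j => ¬ Disjoint (S p) (S j))
    (fun p => T.filter fun j => ∃ k ∈ T.filter (fun j => ¬ Disjoint (S p) (S j)),
      ¬ Disjoint (S k) (S j))
    (fun p _ g g' h => by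
      have h1 : g p.1 = g' p.1 := h p.1 (by simp [hS])
      have h2 : g p.2 = g' p.2 := h p.2 (by simp [hS])
      simp only [hX, h1, h2])
    (fun p _ g => by
      simp only [hX, weight]
      refine (abs_add_le _ _).trans ?_
      rw [mul_add]
      refine add_le_add ?_ ?_
      · rw [abs_mul, abs_of_nonneg (div_nonneg (adj_nonneg _ _) two_pos.le), mul_comm]
        have := adj_nonneg (Gr := Gr) p.1 p.2
        exact mul_le_mul (hΦ _ _) (by linarith) (by linarith) hK
      · split_ifs
        · rw [abs_mul, mul_comm]
          exact mul_le_mul (hφ _) (hcd _) (abs_nonneg _) hK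
        · simp)
    (fun p hp => by
      simp only [hX, expect_add_distrib, ← mul_expect]
      by_cases h : p.1 = p.2
      · simp only [h, adj_self, if_true, ← mul_expect]
        rw [expect_comp_eval φ, hφ0]
        simp
      · simp [h, hΦ0 _ _ h])
    (fun _ => rfl) (fun _ => rfl)
  simp only [hstat] at key
  refine key.trans ?_
  rw [mul_assoc]
  refine mul_le_mul_of_nonneg_left ?_ (by norm_num)
  have hw := fun p => weight_nonneg (Gr := Gr) hc0 p
  have hl := fun V => load_nonneg (Gr := Gr) hc0 V
  calc _ ≤ ∑ p ∈ T, K ^ 3 * (weight Gr c p * load Gr c {p.1, p.2}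
        * load Gr c (nbhd Gr p.1 p.2)) := sum_le_sum fun p hp => ?_
    _ ≤ ∑ p, K ^ 3 * (weight Gr c p * load Gr c {p.1, p.2} * load Gr c (nbhd Gr p.1 p.2)) :=
      sum_le_sum_of_subset_of_nonneg (subset_univ _) fun p _ _ =>
        mul_nonneg (by positivity) (mul_nonneg (mul_nonneg (hw p) (hl _)) (hl _))
    _ ≤ _ := by
      rw [← mul_sum]
      exact mul_le_mul_of_nonneg_left (sum_weight_mul_load_le hc0) (by positivity)
  have hA : ∑ j ∈ T.filter (fun j => ¬ Disjoint (S p) (S j)), K * weight Gr c j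
      ≤ K * load Gr c {p.1, p.2} := by
    rw [← mul_sum]
    refine mul_le_mul_of_nonneg_left (sum_weight_le hc0 _ fun j hj => ?_) hK
    obtain ⟨x, hx, hx'⟩ := Set.not_disjoint_iff.1 (mem_filter.1 hj).2
    simp only [hS, Set.mem_insert_iff, Set.mem_singleton_iff] at hx hx'
    simp only [mem_insert, mem_singleton]
    rcases hx' with rfl | rfl
    · exact Or.inl hx
    · exact Or.inr hx
  have hB : ∑ j ∈ T.filter (fun j => ∃ k ∈ T.filter (fun j => ¬ Disjoint (S p) (S j)),
      ¬ Disjoint (S k) (S j)), K * weight Gr c j ≤ K * load Gr c (nbhd Gr p.1 p.2) := by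
    rw [← mul_sum]
    refine mul_le_mul_of_nonneg_left (sum_weight_le hc0 _ fun j hj => ?_) hK
    obtain ⟨k, hk, hkj⟩ := (mem_filter.1 hj).2
    obtain ⟨hkT, hpk⟩ := mem_filter.1 hk
    obtain ⟨x, hx, hx'⟩ := Set.not_disjoint_iff.1 hkj
    obtain ⟨y, hy, hy'⟩ := Set.not_disjoint_iff.1 hpk
    simp only [hS, Set.mem_insert_iff, Set.mem_singleton_iff] at hx hx' hy hy'
    have hxy : x = y ∨ adj Gr y x ≠ 0 := by
      rcases (mem_filter.1 hkT).2 with h | h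
      · rcases hx with rfl | rfl <;> rcases hy' with rfl | rfl
        · exact Or.inl rfl
        · exact Or.inr (by rwa [adj_symm])
        · exact Or.inr h
        · exact Or.inl rfl
      · left
        rw [← h, or_self] at hx hy'
        rw [hx, hy']
    have hxn : x ∈ nbhd Gr p.1 p.2 := by
      rw [nbhd, mem_filter]
      refine ⟨mem_univ _, ?_⟩
      rcases hxy with rfl | h
      · tauto
      · rcases hy with rfl | rfl <;> tauto
    rcases hx' with rfl | rfl
    · exact Or.inl hxn
    · exact Or.inr hxn
  calc _ ≤ K * weight Gr c p * (K * load Gr c {p.1, p.2}) * (K * load Gr c (nbhd Gr p.1 p.2)) := by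
        refine mul_le_mul (mul_le_mul_of_nonneg_left hA (mul_nonneg hK (hw p))) hB
          (sum_nonneg fun j _ => mul_nonneg hK (hw j)) ?_
        exact mul_nonneg (mul_nonneg hK (hw p)) (mul_nonneg hK (hl _))
    _ = _ := by ring

end IndependentLabels

section Moments

open Finset

variable {n ℓ : ℕ} (Gr : Finset (Sym2 (Node n ℓ)))

/-- Centered edge statistic of a labelling at time `t`. -/
def edgeStat (t : ℕ) (g : Fin n → Fin n) : ℝ :=
  (∑ u, ∑ v, adj Gr u v * (zc t (g u) * zc t (g v))) / 2

/-- Centered degree statistic of a labelling at time `t`. -/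
def degStat (t : ℕ) (g : Fin n → Fin n) : ℝ := ∑ u, cdeg Gr u * zc t (g u)

variable {Gr}

lemma expect_zc_pair [NeZero n] {s t : ℕ} (hs : s ≤ n) (u v : Fin n) :
    𝔼 g : Fin n → Fin n, zc s (g u) * zc t (g v)
      = if u = v then 𝔼 a : Fin n, zc s a * zc t a else 0 := by
  split_ifs with h
  · subst h
    exact expect_comp_eval (fun a => zc s a * zc t a) u
  · exact expect_zc_mul_eq_zero hs (dependsOn_zc t v) (by simpa using h)

lemma expect_zc_triple [NeZero n] {s t : ℕ} (hs : s ≤ n) {u v : Fin n} (w : Fin n) (huv : u ≠ v) :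
    𝔼 g : Fin n → Fin n, zc s (g u) * zc s (g v) * zc t (g w) = 0 := by
  have key : ∀ u v : Fin n, u ≠ v → u ≠ w →
      𝔼 g : Fin n → Fin n, zc s (g u) * zc s (g v) * zc t (g w) = 0 := fun u v h1 h2 => by
    have hd : DependsOn (fun g : Fin n → Fin n => zc s (g v) * zc t (g w)) {v, w} :=
      fun _ _ h => by simp [h v (by simp), h w (by simp)]
    simp_rw [mul_assoc]
    exact expect_zc_mul_eq_zero hs hd (by simp [h1, h2])
  by_cases h : u = w
  · rw [← key v u huv.symm (h ▸ huv.symm)]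
    exact expect_congr rfl fun g _ => by ring
  · exact key u v huv h

lemma expect_zc_quad [NeZero n] {s t : ℕ} (hs : s ≤ n) {u v w x : Fin n} (huv : u ≠ v)
    (hwx : w ≠ x) :
    𝔼 g : Fin n → Fin n, zc s (g u) * zc s (g v) * (zc t (g w) * zc t (g x))
      = if s(u, v) = s(w, x) then (𝔼 a : Fin n, zc s a * zc t a) ^ 2 else 0 := by
  have key : ∀ u v : Fin n, u ≠ v → u ≠ w → u ≠ x →
      𝔼 g : Fin n → Fin n, zc s (g u) * zc s (g v) * (zc t (g w) * zc t (g x)) = 0 :=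
    fun u v h1 h2 h3 => by
      have hd : DependsOn (fun g : Fin n → Fin n => zc s (g v) * (zc t (g w) * zc t (g x)))
          {v, w, x} := fun _ _ h => by
        simp [h v (by simp), h w (by simp), h x (by simp)]
      simp_rw [mul_assoc]
      exact expect_zc_mul_eq_zero hs hd (by simp [h1, h2, h3])
  have hpair : ∀ w x : Fin n, w ≠ x →
      𝔼 g : Fin n → Fin n, zc s (g w) * zc s (g x) * (zc t (g w) * zc t (g x))
        = (𝔼 a : Fin n, zc s a * zc t a) ^ 2 := fun w x h => by
    have h1 : ∀ u, DependsOn (fun g : Fin n → Fin n => zc s (g u) * zc t (g u)) {u} :=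
      fun u _ _ h => by simp [h u rfl]
    have h2 := expect_mul_of_disjoint (h1 w) (h1 x) (by simpa using h)
    rw [expect_comp_eval (fun a => zc s a * zc t a), expect_comp_eval (fun a => zc s a * zc t a)]
      at h2
    rw [sq, ← h2]
    exact expect_congr rfl fun g _ => by ring
  by_cases hu : u ≠ w ∧ u ≠ x
  · rw [key u v huv hu.1 hu.2, if_neg]
    simp [hu.1, hu.2]
  by_cases hv : v ≠ w ∧ v ≠ x
  · rw [if_neg (by simp [hv.1, hv.2]), ← key v u huv.symm hv.1 hv.2]
    exact expect_congr rfl fun g _ => by ring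
  have hcase : (u = w ∧ v = x) ∨ (u = x ∧ v = w) := by
    by_cases h1 : u = w
    · left; subst h1; exact ⟨rfl, by tauto⟩
    · right
      have h2 : u = x := by tauto
      subst h2; exact ⟨rfl, by tauto⟩
  rcases hcase with ⟨rfl, rfl⟩ | ⟨rfl, rfl⟩
  · rw [if_pos rfl, hpair _ _ huv]
  · rw [if_pos Sym2.eq_swap, ← hpair _ _ huv]
    exact expect_congr rfl fun g _ => by ring

lemma expect_degStat [NeZero n] {t : ℕ} (ht : t ≤ n) : 𝔼 g, degStat Gr t g = 0 := by
  simp only [degStat, expect_sum_comm, ← mul_expect]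
  refine sum_eq_zero fun u _ => ?_
  rw [expect_comp_eval (fun a => zc t a), expect_zc ht, mul_zero]

lemma expect_edgeStat [NeZero n] {t : ℕ} (ht : t ≤ n) : 𝔼 g, edgeStat Gr t g = 0 := by
  simp only [edgeStat, ← expect_div, expect_sum_comm, ← mul_expect]
  rw [sum_eq_zero fun u _ => sum_eq_zero fun v _ => ?_, zero_div]
  rw [expect_zc_pair ht]
  split_ifs with h
  · rw [h, adj_self, zero_mul]
  · rw [mul_zero]

lemma expect_degStat_mul [NeZero n] {s t : ℕ} (hs : s ≤ n) :
    𝔼 g, degStat Gr s g * degStat Gr t g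
      = (∑ u, cdeg Gr u ^ 2) * 𝔼 a : Fin n, zc s a * zc t a := by
  have e : ∀ g : Fin n → Fin n, degStat Gr s g * degStat Gr t g
      = ∑ u, ∑ v, cdeg Gr u * cdeg Gr v * (zc s (g u) * zc t (g v)) := fun g => by
    rw [degStat, degStat, sum_mul_sum]
    exact sum_congr rfl fun u _ => sum_congr rfl fun v _ => by ring
  simp only [e, expect_sum_comm, ← mul_expect, expect_zc_pair hs]
  rw [sum_mul]
  refine sum_congr rfl fun u _ => ?_
  simp only [mul_ite, mul_zero, sum_ite_eq, mem_univ, if_true]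
  ring

lemma expect_edgeStat_mul_degStat [NeZero n] {s t : ℕ} (hs : s ≤ n) :
    𝔼 g, edgeStat Gr s g * degStat Gr t g = 0 := by
  have e : ∀ g : Fin n → Fin n, edgeStat Gr s g * degStat Gr t g
      = ∑ u, ∑ v, ∑ w, adj Gr u v / 2 * cdeg Gr w * (zc s (g u) * zc s (g v) * zc t (g w)) :=
    fun g => by
      rw [edgeStat, degStat, sum_div, sum_mul]
      refine sum_congr rfl fun u _ => ?_
      rw [sum_div, sum_mul]
      refine sum_congr rfl fun v _ => ?_
      rw [mul_sum]
      exact sum_congr rfl fun w _ => by ring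
  simp only [e, expect_sum_comm, ← mul_expect]
  refine sum_eq_zero fun u _ => sum_eq_zero fun v _ => sum_eq_zero fun w _ => ?_
  by_cases h : u = v
  · rw [h, adj_self]; simp
  · rw [expect_zc_triple hs w h, mul_zero]

lemma expect_edgeStat_mul [NeZero n] {s t : ℕ} (hs : s ≤ n) :
    𝔼 g, edgeStat Gr s g * edgeStat Gr t g
      = (∑ u, ∑ v, adj Gr u v ^ 2) / 2 * (𝔼 a : Fin n, zc s a * zc t a) ^ 2 := by
  have e : ∀ g : Fin n → Fin n, edgeStat Gr s g * edgeStat Gr t g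
      = ∑ u, ∑ v, ∑ w, ∑ x, adj Gr u v / 2 * (adj Gr w x / 2)
        * (zc s (g u) * zc s (g v) * (zc t (g w) * zc t (g x))) :=
    fun g => by
      rw [edgeStat, edgeStat, sum_div, sum_mul]
      refine sum_congr rfl fun u _ => ?_
      rw [sum_div, sum_mul]
      refine sum_congr rfl fun v _ => ?_
      rw [sum_div, mul_sum]
      refine sum_congr rfl fun w _ => ?_
      rw [sum_div, mul_sum]
      exact sum_congr rfl fun x _ => by ring
  simp only [e, expect_sum_comm, ← mul_expect]
  set κ := 𝔼 a : Fin n, zc s a * zc t a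
  rw [sum_div, sum_mul]
  refine sum_congr rfl fun u _ => ?_
  rw [sum_div, sum_mul]
  refine sum_congr rfl fun v _ => ?_
  by_cases h : u = v
  · rw [h, adj_self]; simp
  have h1 : ∀ w x, adj Gr u v / 2 * (adj Gr w x / 2)
        * (𝔼 g : Fin n → Fin n, zc s (g u) * zc s (g v) * (zc t (g w) * zc t (g x)))
      = if s(u, v) = s(w, x) then adj Gr u v ^ 2 / 4 * κ ^ 2 else 0 := fun w x => by
    by_cases hwx : w = x
    · rw [hwx, adj_self, if_neg]
      · simp
      · intro hc
        simp only [Sym2.eq_iff] at hc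
        rcases hc with ⟨rfl, rfl⟩ | ⟨rfl, rfl⟩ <;> exact h rfl
    · rw [expect_zc_quad hs h hwx]
      split_ifs with hp
      · have : adj Gr w x = adj Gr u v := by rw [adj, adj, hp]
        rw [this]; ring
      · rw [mul_zero]
  simp only [h1]
  rw [sum_ite_pair_eq (p := s(u, v)) (by simpa using h) fun _ => adj Gr u v ^ 2 / 4 * κ ^ 2]
  ring

end Moments

section MeanSquare

open Finset Complex Filter Topology

section Fixed

variable {Ω : Type*} [Fintype Ω]

lemma abs_expect_mul_le_sqrt (f g : Ω → ℝ) :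
    |𝔼 ω, f ω * g ω| ≤ Real.sqrt (𝔼 ω, f ω ^ 2) * Real.sqrt (𝔼 ω, g ω ^ 2) := by
  rw [← Real.sqrt_mul (expect_nonneg fun ω _ => sq_nonneg (f ω))]
  exact Real.abs_le_sqrt (expect_mul_sq_le_sq_mul_sq _ _ _)

lemma expect_abs_le_sqrt [Nonempty Ω] (f : Ω → ℝ) :
    𝔼 ω, |f ω| ≤ Real.sqrt (𝔼 ω, f ω ^ 2) := by
  have := (le_abs_self _).trans (abs_expect_mul_le_sqrt (fun ω => |f ω|) fun _ => 1)
  simpa [Fintype.expect_const] using this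

lemma expect_sub_expect_sq_le [Nonempty Ω] (W : Ω → ℝ) :
    𝔼 ω, (W ω - 𝔼 ω', W ω') ^ 2 ≤ 𝔼 ω, W ω ^ 2 := by
  set m := 𝔼 ω', W ω' with hm
  have e : ∀ ω, (W ω - m) ^ 2 = W ω ^ 2 - 2 * m * W ω + m ^ 2 := fun ω => by ring
  simp only [e, expect_add_distrib, expect_sub_distrib, ← mul_expect, Fintype.expect_const, ← hm]
  nlinarith [sq_nonneg m]

/-- Standardization of a random variable on a finite uniform probability space. -/
def stdz (X : Ω → ℝ) (ω : Ω) : ℝ :=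
  (X ω - 𝔼 ω', X ω') / Real.sqrt (𝔼 ω', (X ω' - 𝔼 ω'', X ω'') ^ 2)

lemma stdz_div (X : Ω → ℝ) {b : ℝ} (hb : 0 < b) : stdz (fun ω => X ω / b) = stdz X := by
  ext ω
  simp only [stdz, ← expect_div, ← sub_div, div_pow]
  rw [Real.sqrt_div' _ (sq_nonneg b), Real.sqrt_sq hb.le, div_div_div_cancel_right₀ hb.ne']

lemma norm_exp_mul_I_sub_le (a b : ℝ) : ‖cexp (a * I) - cexp (b * I)‖ ≤ |a - b| := by
  have : cexp (a * I) - cexp (b * I) = cexp (b * I) * (cexp (I * ((a - b : ℝ) : ℂ)) - 1) := by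
    rw [mul_sub, ← Complex.exp_add]
    push_cast
    ring_nf
  rw [this, norm_mul, Complex.norm_exp_ofReal_mul_I, one_mul]
  exact Real.norm_exp_I_mul_ofReal_sub_one_le

end Fixed

variable {Ω : ℕ → Type*} [∀ n, Fintype (Ω n)]

lemma tendsto_expect_mul_zero {f g : ∀ n, Ω n → ℝ} {b : ℝ}
    (hf : Tendsto (fun n => 𝔼 ω, f n ω ^ 2) atTop (𝓝 0))
    (hg : Tendsto (fun n => 𝔼 ω, g n ω ^ 2) atTop (𝓝 b)) :
    Tendsto (fun n => 𝔼 ω, f n ω * g n ω) atTop (𝓝 0) := by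
  refine squeeze_zero_norm (fun n => abs_expect_mul_le_sqrt (f n) (g n)) ?_
  have := hf.sqrt.mul hg.sqrt
  simpa using this

lemma tendsto_expect_mul_of_close {X Y X' Y' : ∀ n, Ω n → ℝ} {a b K : ℝ}
    (h : Tendsto (fun n => 𝔼 ω, (X n ω - Y n ω) ^ 2) atTop (𝓝 0))
    (h' : Tendsto (fun n => 𝔼 ω, (X' n ω - Y' n ω) ^ 2) atTop (𝓝 0))
    (ha : Tendsto (fun n => 𝔼 ω, Y n ω ^ 2) atTop (𝓝 a))
    (hb : Tendsto (fun n => 𝔼 ω, Y' n ω ^ 2) atTop (𝓝 b))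
    (hK : Tendsto (fun n => 𝔼 ω, Y n ω * Y' n ω) atTop (𝓝 K)) :
    Tendsto (fun n => 𝔼 ω, X n ω * X' n ω) atTop (𝓝 K) := by
  have e : ∀ n, 𝔼 ω, X n ω * X' n ω = (𝔼 ω, (X n ω - Y n ω) * (X' n ω - Y' n ω))
      + (𝔼 ω, (X n ω - Y n ω) * Y' n ω) + (𝔼 ω, (X' n ω - Y' n ω) * Y n ω)
      + 𝔼 ω, Y n ω * Y' n ω := fun n => by
    simp only [← expect_add_distrib]
    exact expect_congr rfl fun ω _ => by ring
  simp only [e]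
  have := (((tendsto_expect_mul_zero h h').add (tendsto_expect_mul_zero h hb)).add
    (tendsto_expect_mul_zero h' ha)).add hK
  simpa using this

variable [∀ n, Nonempty (Ω n)] {M : Type*} {X Y : ∀ n, M → Ω n → ℝ} {C : ℕ → M → ℝ}
  {K : M → M → ℝ}

lemma tendsto_centered_close
    (hXY : ∀ m, Tendsto (fun n => 𝔼 ω, (X n m ω - C n m - Y n m ω) ^ 2) atTop (𝓝 0))
    (hY0 : ∀ m, ∀ᶠ n in atTop, 𝔼 ω, Y n m ω = 0) (m : M) :
    Tendsto (fun n => 𝔼 ω, (X n m ω - (𝔼 ω', X n m ω') - Y n m ω) ^ 2) atTop (𝓝 0) := by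
  refine tendsto_of_tendsto_of_tendsto_of_le_of_le' tendsto_const_nhds (hXY m)
    (Eventually.of_forall fun n => expect_nonneg fun ω _ => sq_nonneg _) ?_
  filter_upwards [hY0 m] with n hn
  refine le_trans (le_of_eq ?_) (expect_sub_expect_sq_le fun ω => X n m ω - C n m - Y n m ω)
  refine expect_congr rfl fun ω _ => ?_
  simp only [expect_sub_distrib, hn, Fintype.expect_const]
  ring

lemma tendsto_centered_mul
    (hXY : ∀ m, Tendsto (fun n => 𝔼 ω, (X n m ω - C n m - Y n m ω) ^ 2) atTop (𝓝 0))
    (hY0 : ∀ m, ∀ᶠ n in atTop, 𝔼 ω, Y n m ω = 0)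
    (hYY : ∀ m m', Tendsto (fun n => 𝔼 ω, Y n m ω * Y n m' ω) atTop (𝓝 (K m m'))) (m m' : M) :
    Tendsto (fun n => 𝔼 ω, (X n m ω - 𝔼 ω', X n m ω') * (X n m' ω - 𝔼 ω', X n m' ω')) atTop
      (𝓝 (K m m')) :=
  tendsto_expect_mul_of_close (tendsto_centered_close hXY hY0 m)
    (tendsto_centered_close hXY hY0 m') (by simpa only [sq] using hYY m m)
    (by simpa only [sq] using hYY m' m') (hYY m m')

lemma tendsto_expect_stdz_mul
    (hXY : ∀ m, Tendsto (fun n => 𝔼 ω, (X n m ω - C n m - Y n m ω) ^ 2) atTop (𝓝 0))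
    (hY0 : ∀ m, ∀ᶠ n in atTop, 𝔼 ω, Y n m ω = 0)
    (hYY : ∀ m m', Tendsto (fun n => 𝔼 ω, Y n m ω * Y n m' ω) atTop (𝓝 (K m m')))
    (hK : ∀ m, 0 < K m m) (m m' : M) :
    Tendsto (fun n => 𝔼 ω, stdz (X n m) ω * stdz (X n m') ω) atTop
      (𝓝 (K m m' / (Real.sqrt (K m m) * Real.sqrt (K m' m')))) := by
  have hs : ∀ m, Tendsto (fun n => Real.sqrt (𝔼 ω, (X n m ω - 𝔼 ω', X n m ω') ^ 2)) atTop
      (𝓝 (Real.sqrt (K m m))) := fun m => by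
    simpa only [sq] using (tendsto_centered_mul hXY hY0 hYY m m).sqrt
  have := (tendsto_centered_mul hXY hY0 hYY m m').div ((hs m).mul (hs m'))
    (mul_pos (Real.sqrt_pos.2 (hK m)) (Real.sqrt_pos.2 (hK m'))).ne'
  refine this.congr fun n => ?_
  simp only [Pi.div_apply, expect_div]
  exact expect_congr rfl fun ω _ => by rw [stdz, stdz, div_mul_div_comm]

lemma tendsto_stdz_close
    (hXY : ∀ m, Tendsto (fun n => 𝔼 ω, (X n m ω - C n m - Y n m ω) ^ 2) atTop (𝓝 0))
    (hY0 : ∀ m, ∀ᶠ n in atTop, 𝔼 ω, Y n m ω = 0)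
    (hYY : ∀ m m', Tendsto (fun n => 𝔼 ω, Y n m ω * Y n m' ω) atTop (𝓝 (K m m')))
    (hK : ∀ m, 0 < K m m) (m : M) :
    Tendsto (fun n => 𝔼 ω, (stdz (X n m) ω - Y n m ω / Real.sqrt (K m m)) ^ 2) atTop (𝓝 0) := by
  have hk := Real.sqrt_pos.2 (hK m)
  have hXX : Tendsto (fun n => 𝔼 ω, (X n m ω - 𝔼 ω', X n m ω') ^ 2) atTop (𝓝 (K m m)) := by
    simpa only [sq] using tendsto_centered_mul hXY hY0 hYY m m
  have hinv := (hXX.sqrt.inv₀ hk.ne').sub_const (Real.sqrt (K m m))⁻¹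
  have hlim := (((hinv.pow 2).mul hXX).const_mul 2).add
    ((tendsto_centered_close hXY hY0 m).const_mul (2 * ((Real.sqrt (K m m))⁻¹) ^ 2))
  rw [sub_self, zero_pow two_ne_zero, zero_mul, mul_zero, mul_zero, add_zero] at hlim
  refine squeeze_zero (fun n => expect_nonneg fun ω _ => sq_nonneg _) (fun n => ?_) hlim
  simp only [mul_expect, ← expect_add_distrib]
  refine expect_le_expect fun ω _ => ?_
  rw [stdz]
  set x := X n m ω - 𝔼 ω', X n m ω'
  set a := (Real.sqrt (𝔼 ω', (X n m ω' - 𝔼 ω'', X n m ω'') ^ 2))⁻¹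
  set b := (Real.sqrt (K m m))⁻¹
  rw [div_eq_mul_inv, div_eq_mul_inv]
  nlinarith [sq_nonneg ((a - b) * x - b * (x - Y n m ω))]

lemma tendsto_expect_exp_stdz [Fintype M]
    (hXY : ∀ m, Tendsto (fun n => 𝔼 ω, (X n m ω - C n m - Y n m ω) ^ 2) atTop (𝓝 0))
    (hY0 : ∀ m, ∀ᶠ n in atTop, 𝔼 ω, Y n m ω = 0)
    (hYY : ∀ m m', Tendsto (fun n => 𝔼 ω, Y n m ω * Y n m' ω) atTop (𝓝 (K m m')))
    (hK : ∀ m, 0 < K m m)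
    (hchar : ∀ θ : M → ℝ, Tendsto (fun n => (𝔼 ω, cexp ((∑ m, θ m * Y n m ω : ℝ) * I))
      - cexp (-((𝔼 ω, (∑ m, θ m * Y n m ω) ^ 2 : ℝ) : ℂ) / 2)) atTop (𝓝 0)) (θ : M → ℝ) :
    Tendsto (fun n => 𝔼 ω, cexp ((∑ m, θ m * stdz (X n m) ω : ℝ) * I)) atTop
      (𝓝 (cexp (-((∑ m, ∑ m', θ m * θ m'
        * (K m m' / (Real.sqrt (K m m) * Real.sqrt (K m' m'))) : ℝ) : ℂ) / 2))) := by
  set ξ : M → ℝ := fun m => θ m / Real.sqrt (K m m) with hξ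
  have h1 : Tendsto (fun n => (𝔼 ω, cexp ((∑ m, θ m * stdz (X n m) ω : ℝ) * I))
      - 𝔼 ω, cexp ((∑ m, ξ m * Y n m ω : ℝ) * I)) atTop (𝓝 0) := by
    have hlim : Tendsto (fun n => ∑ m, |θ m| * Real.sqrt
        (𝔼 ω, (stdz (X n m) ω - Y n m ω / Real.sqrt (K m m)) ^ 2)) atTop (𝓝 0) := by
      have := tendsto_finsetSum univ fun m (_ : m ∈ univ) =>
        (tendsto_stdz_close hXY hY0 hYY hK m).sqrt.const_mul |θ m|
      simpa using this
    refine squeeze_zero_norm (fun n => ?_) hlim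
    rw [← expect_sub_distrib]
    refine (norm_expect_le _).trans ?_
    calc _ ≤ 𝔼 ω, ∑ m, |θ m| * |stdz (X n m) ω - Y n m ω / Real.sqrt (K m m)| :=
          expect_le_expect fun ω _ => by
            refine (norm_exp_mul_I_sub_le _ _).trans ?_
            rw [← sum_sub_distrib]
            refine (abs_sum_le_sum_abs _ _).trans (le_of_eq (sum_congr rfl fun m _ => ?_))
            rw [← abs_mul, hξ]
            congr 1
            ring
      _ ≤ _ := by
        rw [expect_sum_comm]
        refine sum_le_sum fun m _ => ?_
        rw [← mul_expect]
        exact mul_le_mul_of_nonneg_left (expect_abs_le_sqrt _) (abs_nonneg _)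
  have h2 : Tendsto (fun n => cexp (-((𝔼 ω, (∑ m, ξ m * Y n m ω) ^ 2 : ℝ) : ℂ) / 2)) atTop
      (𝓝 (cexp (-((∑ m, ∑ m', θ m * θ m'
        * (K m m' / (Real.sqrt (K m m) * Real.sqrt (K m' m'))) : ℝ) : ℂ) / 2))) := by
    have e : ∀ n, 𝔼 ω, (∑ m, ξ m * Y n m ω) ^ 2
        = ∑ m, ∑ m', ξ m * ξ m' * 𝔼 ω, Y n m ω * Y n m' ω := fun n => by
      simp only [mul_expect, ← expect_sum_comm]
      refine expect_congr rfl fun ω _ => ?_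
      rw [sq, sum_mul_sum]
      exact sum_congr rfl fun m _ => sum_congr rfl fun m' _ => by ring
    have hl : Tendsto (fun n => 𝔼 ω, (∑ m, ξ m * Y n m ω) ^ 2) atTop (𝓝 (∑ m, ∑ m', θ m * θ m'
        * (K m m' / (Real.sqrt (K m m) * Real.sqrt (K m' m'))))) := by
      simp only [e]
      refine tendsto_finsetSum _ fun m _ => tendsto_finsetSum _ fun m' _ => ?_
      refine ((hYY m m').const_mul (ξ m * ξ m')).congr' (Eventually.of_forall fun n => rfl) |>.trans
        (le_of_eq ?_)
      congr 1
      rw [hξ]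
      field_simp
    have hcont : Continuous fun x : ℝ => cexp (-(x : ℂ) / 2) := by fun_prop
    exact (hcont.tendsto _).comp hl
  have := (h1.add (hchar ξ)).add h2
  rw [zero_add, zero_add] at this
  exact this.congr fun n => by ring

end MeanSquare

section Approximation

open Finset Complex Filter Topology

variable {n ℓ : ℕ}

/-- Half the sum of the squared multiplicities of the pairs of individuals. -/
def wnorm (Gr : Finset (Sym2 (Node n ℓ))) : ℝ := (∑ u, ∑ v, adj Gr u v ^ 2) / 2

/-- Sum of the squared centered degrees. -/
def dnorm (Gr : Finset (Sym2 (Node n ℓ))) : ℝ := ∑ u, cdeg Gr u ^ 2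

variable {Gr : Finset (Sym2 (Node n ℓ))}

lemma one_div_sqrt_le_one [NeZero n] : 1 / Real.sqrt n ≤ 1 := by
  have : (1 : ℝ) ≤ n := by exact_mod_cast Nat.one_le_iff_ne_zero.2 (NeZero.ne n)
  rw [div_le_one (by positivity)]
  exact Real.one_le_sqrt.2 this

lemma expect_degStat_sub_sq_le [NeZero n] {t : ℕ} (ht : t ≤ n) :
    𝔼 ω : Coup n, (degStat Gr t ω.2 - degStat Gr t (label ω)) ^ 2
      ≤ 4 * (1 / Real.sqrt n) * dnorm Gr := by
  refine le_trans (le_of_eq ?_) ((exchCoupling ht).linear (cdeg Gr) sum_cdeg)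
  refine expect_congr rfl fun ω _ => ?_
  simp only [degStat, ← sum_sub_distrib, mul_sub]

lemma exists_expect_Routd_close [NeZero n] {t : ℕ} (ht : t ≤ n) (hA : 0 < dnorm Gr) :
    ∃ C : ℝ, 𝔼 ω : Coup n, (Routd Gr t ω.2 / Real.sqrt (dnorm Gr) - C
      - degStat Gr t (label ω) / Real.sqrt (dnorm Gr)) ^ 2 ≤ 4 * (1 / Real.sqrt n) := by
  obtain ⟨C, hC⟩ := exists_Routd_eq (Gr := Gr) ht
  refine ⟨C / Real.sqrt (dnorm Gr), ?_⟩
  have e : ∀ ω : Coup n, (Routd Gr t ω.2 / Real.sqrt (dnorm Gr) - C / Real.sqrt (dnorm Gr)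
      - degStat Gr t (label ω) / Real.sqrt (dnorm Gr)) ^ 2
      = (degStat Gr t ω.2 - degStat Gr t (label ω)) ^ 2 / dnorm Gr := fun ω => by
    rw [← sub_div, ← sub_div, div_pow, Real.sq_sqrt hA.le, hC, degStat, degStat]
    congr 2
    ring
  simp only [e, ← expect_div]
  rw [div_le_iff₀ hA]
  exact expect_degStat_sub_sq_le ht

lemma abs_expect_zc_mul_zc_le [NeZero n] {t : ℕ} (ht : t ≤ n) :
    𝔼 a : Fin n, zc t a * zc t a ≤ 1 := by
  refine (expect_le_expect fun a _ => ?_).trans (Fintype.expect_const (1 : ℝ)).le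
  have := abs_zc_le ht a
  nlinarith [abs_mul_abs_self (zc t a), abs_nonneg (zc t a)]

lemma expect_degStat_perm_sq_le [NeZero n] {t : ℕ} (ht : t ≤ n) :
    𝔼 ω : Coup n, degStat Gr t ω.2 ^ 2 ≤ 10 * dnorm Gr := by
  have hA : 0 ≤ dnorm Gr := sum_nonneg fun u _ => sq_nonneg _
  have h1 := expect_degStat_sub_sq_le (Gr := Gr) ht
  have h2 : 𝔼 ω : Coup n, degStat Gr t (label ω) ^ 2 ≤ dnorm Gr := by
    rw [expect_label fun g => degStat Gr t g ^ 2]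
    simp only [sq]
    rw [expect_degStat_mul ht]
    exact mul_le_of_le_one_right hA (abs_expect_zc_mul_zc_le ht)
  have h3 : 𝔼 ω : Coup n, degStat Gr t ω.2 ^ 2
      ≤ 2 * (𝔼 ω : Coup n, (degStat Gr t ω.2 - degStat Gr t (label ω)) ^ 2)
        + 2 * 𝔼 ω : Coup n, degStat Gr t (label ω) ^ 2 := by
    simp only [mul_expect, ← expect_add_distrib]
    refine expect_le_expect fun ω _ => ?_
    nlinarith [sq_nonneg (degStat Gr t ω.2 - 2 * degStat Gr t (label ω))]
  have h4 := mul_le_mul_of_nonneg_right (one_div_sqrt_le_one (n := n)) hA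
  linarith

lemma exists_expect_Routw_close [NeZero n] {t : ℕ} (ht : t ≤ n) (hn : 4 ≤ n) {c C : ℝ}
    (hc : 0 < c) (hC : 0 < C) (hA : dnorm Gr ≤ C * n) (hB : c * n ≤ wnorm Gr)
    (hm : ((Gout Gr).card : ℝ) ≤ C * n) :
    ∃ C' : ℝ, 𝔼 ω : Coup n, (Routw Gr t ω.2 / Real.sqrt (wnorm Gr) - C'
      - edgeStat Gr t (label ω) / Real.sqrt (wnorm Gr)) ^ 2
      ≤ (88 * C + 320 * C ^ 2) / c * (1 / Real.sqrt n) := by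
  have hn4 : (4 : ℝ) ≤ n := by exact_mod_cast hn
  have hn0 : (0 : ℝ) < n := by linarith
  have hB0 : 0 < wnorm Gr := lt_of_lt_of_le (by positivity) hB
  obtain ⟨C', η, hη, hR⟩ := exists_Routw_eq (Gr := Gr) (by omega) ht
  refine ⟨C' / Real.sqrt (wnorm Gr), ?_⟩
  set ε : ℝ := 1 / Real.sqrt n with hε
  have hs := Real.sqrt_pos.2 hn0
  have hε0 : 0 < ε := by positivity
  set Q : Coup n → ℝ := fun ω => ∑ u, ∑ v, adj Gr u v
    * (zc t (ω.2 u) * zc t (ω.2 v) - zc t (label ω u) * zc t (label ω v)) with hQ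
  have e : ∀ ω : Coup n, (Routw Gr t ω.2 / Real.sqrt (wnorm Gr) - C' / Real.sqrt (wnorm Gr)
      - edgeStat Gr t (label ω) / Real.sqrt (wnorm Gr)) ^ 2
      = (Q ω / 2 + η * degStat Gr t ω.2) ^ 2 / wnorm Gr := fun ω => by
    rw [← sub_div, ← sub_div, div_pow, Real.sq_sqrt hB0.le, hR, degStat, edgeStat]
    congr 2
    simp only [hQ, mul_sub, sum_sub_distrib]
    ring
  have hQ2 : 𝔼 ω, Q ω ^ 2 ≤ ε * n * (16 * C + 640 * C ^ 2) := by
    have h := (exchCoupling ht).quadratic (by omega) (adj Gr) adj_nonneg adj_self adj_symm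
    refine h.trans ?_
    simp only [← cast_Ddeg, sum_Ddeg]
    have hD : ∑ u, (Ddeg Gr u : ℝ) ^ 2 ≤ (C + 4 * C ^ 2) * n := by
      have h1 := sum_cdeg_sq (Gr := Gr)
      have h2 : 4 * ((Gout Gr).card : ℝ) ^ 2 / n ≤ 4 * C ^ 2 * n := by
        rw [div_le_iff₀ hn0]
        nlinarith [pow_le_pow_left₀ (Nat.cast_nonneg (α := ℝ) _) hm 2]
      rw [dnorm] at hA
      linarith
    have h36 : 36 * ε / ((n : ℝ) - 3) ≤ 144 * ε / n := by
      rw [div_le_div_iff₀ (by linarith) hn0]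
      nlinarith
    have hG2 : (2 * ((Gout Gr).card : ℝ)) ^ 2 ≤ 4 * C ^ 2 * n ^ 2 := by
      nlinarith [pow_le_pow_left₀ (Nat.cast_nonneg (α := ℝ) _) hm 2]
    calc _ ≤ 16 * ε * ((C + 4 * C ^ 2) * n) + 144 * ε / n * (4 * C ^ 2 * n ^ 2) := by
          refine add_le_add (mul_le_mul_of_nonneg_left hD (by positivity)) ?_
          exact mul_le_mul h36 hG2 (by positivity) (by positivity)
      _ = _ := by field_simp; ring
  have hη2 : η ^ 2 ≤ 4 / n ^ 2 := by
    have h1 : |η| ≤ 2 / n := by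
      refine hη.trans ?_
      rw [div_le_div_iff₀ (by linarith) hn0]
      linarith
    calc η ^ 2 = |η| ^ 2 := (sq_abs η).symm
      _ ≤ (2 / n) ^ 2 := pow_le_pow_left₀ (abs_nonneg _) h1 2
      _ = _ := by ring
  have hL := expect_degStat_perm_sq_le (Gr := Gr) ht
  have hεn : 1 ≤ ε * n := by
    have : ε * n = Real.sqrt n := by
      rw [hε, div_mul_eq_mul_div, one_mul, div_eq_iff hs.ne', Real.mul_self_sqrt hn0.le]
    rw [this]
    exact Real.one_le_sqrt.2 (by linarith)
  have hmain : 𝔼 ω, (Q ω / 2 + η * degStat Gr t ω.2) ^ 2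
      ≤ (𝔼 ω, Q ω ^ 2) / 2 + 2 * η ^ 2 * 𝔼 ω : Coup n, degStat Gr t ω.2 ^ 2 := by
    simp only [expect_div, mul_expect, ← expect_add_distrib]
    refine expect_le_expect fun ω _ => ?_
    nlinarith [sq_nonneg (Q ω / 2 - η * degStat Gr t ω.2)]
  have hlin : 2 * η ^ 2 * 𝔼 ω : Coup n, degStat Gr t ω.2 ^ 2 ≤ 80 * C * (ε * n) := by
    calc _ ≤ 2 * (4 / (n : ℝ) ^ 2) * (10 * (C * n)) := by
          refine mul_le_mul (by linarith) (hL.trans (by linarith))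
            (expect_nonneg fun ω _ => sq_nonneg _) (by positivity)
      _ = 80 * C * (1 / n) := by field_simp; ring
      _ ≤ _ := by
        refine mul_le_mul_of_nonneg_left (le_trans ?_ hεn) (by positivity)
        rw [div_le_one hn0]; linarith
  simp only [e, ← expect_div]
  rw [div_le_iff₀ hB0]
  have h5 : 𝔼 ω, (Q ω / 2 + η * degStat Gr t ω.2) ^ 2 ≤ ε * n * (88 * C + 320 * C ^ 2) := by
    linarith
  refine h5.trans ?_
  calc ε * n * (88 * C + 320 * C ^ 2)
      = (88 * C + 320 * C ^ 2) / c * ε * (c * n) := by field_simp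
    _ ≤ _ := mul_le_mul_of_nonneg_left hB (by positivity)

end Approximation

section Limits

open Finset Complex Filter Topology

instance (n : ℕ) : Nonempty (Coup n) := ⟨(id, 1)⟩

variable {ℓ k : ℕ} (Gr : ∀ n : ℕ, Finset (Sym2 (Node n ℓ))) (u : Fin k → ℝ)

/-- Covariance kernel of the standard Brownian bridge. -/
def bridge (i j : Fin k) : ℝ := min (u i) (u j) - u i * u j

/-- Limit of the covariances of the normalized edge and degree statistics. -/
def limCov : Fin k ⊕ Fin k → Fin k ⊕ Fin k → ℝ
  | .inl i, .inl j => bridge u i j ^ 2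
  | .inr i, .inr j => bridge u i j
  | .inl _, .inr _ => 0
  | .inr _, .inl _ => 0

/-- The normalized statistics, seen on the coupling space. -/
def rawStat (n : ℕ) : Fin k ⊕ Fin k → Coup n → ℝ
  | .inl i, ω => Routw (Gr n) ⌊(n : ℝ) * u i⌋₊ ω.2 / Real.sqrt (wnorm (Gr n))
  | .inr i, ω => Routd (Gr n) ⌊(n : ℝ) * u i⌋₊ ω.2 / Real.sqrt (dnorm (Gr n))

/-- The approximation of the normalized statistics by functions of independent labels. -/
def indepStat (n : ℕ) : Fin k ⊕ Fin k → Coup n → ℝ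
  | .inl i, ω => edgeStat (Gr n) ⌊(n : ℝ) * u i⌋₊ (label ω) / Real.sqrt (wnorm (Gr n))
  | .inr i, ω => degStat (Gr n) ⌊(n : ℝ) * u i⌋₊ (label ω) / Real.sqrt (dnorm (Gr n))

variable {Gr u}

lemma exists_bounds (h1 : Cond1 ℓ Gr) (h2 : Cond2 ℓ Gr) : ∃ c C : ℝ, 0 < c ∧ 0 < C ∧
    ∀ᶠ n : ℕ in atTop, 4 ≤ n ∧ c * n ≤ dnorm (Gr n) ∧ dnorm (Gr n) ≤ C * n ∧
      c * n ≤ wnorm (Gr n) ∧ ((Gout (Gr n)).card : ℝ) ≤ C * n := by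
  obtain ⟨⟨c₁, C₁, hc₁, H₁⟩, -⟩ := h1
  obtain ⟨⟨c₂, C₂, hc₂, H₂⟩, -⟩ := h2
  refine ⟨min c₁ c₂, max 1 (max C₁ C₂), lt_min hc₁ hc₂, lt_max_of_lt_left one_pos, ?_⟩
  filter_upwards [H₁, H₂, eventually_ge_atTop 4] with n hn₁ hn₂ hn
  have : NeZero n := ⟨by omega⟩
  have hn0 : (0 : ℝ) ≤ n := n.cast_nonneg
  rw [← sum_cdeg_sq] at hn₂
  have e₁ := mul_le_mul_of_nonneg_right (min_le_left c₁ c₂) hn0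
  have e₂ := mul_le_mul_of_nonneg_right (min_le_right c₁ c₂) hn0
  have e₃ := mul_le_mul_of_nonneg_right ((le_max_left C₁ C₂).trans (le_max_right 1 _)) hn0
  have e₄ := mul_le_mul_of_nonneg_right ((le_max_right C₁ C₂).trans (le_max_right 1 _)) hn0
  refine ⟨hn, e₂.trans hn₂.1, hn₂.2.trans e₄, ?_, hn₁.2.trans e₃⟩
  exact (e₁.trans hn₁.1).trans card_le_sum_adj_sq

lemma floor_mul_le {x : ℝ} (hx : x < 1) (n : ℕ) : ⌊(n : ℝ) * x⌋₊ ≤ n :=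
  Nat.floor_le_of_le (mul_le_of_le_one_right n.cast_nonneg hx.le)

lemma tendsto_floor_div {x : ℝ} (hx : 0 < x) :
    Tendsto (fun n : ℕ => (⌊(n : ℝ) * x⌋₊ : ℝ) / n) atTop (𝓝 x) := by
  have := (tendsto_nat_floor_mul_div_atTop (R := ℝ) hx.le).comp tendsto_natCast_atTop_atTop
  refine this.congr fun n => ?_
  simp [mul_comm]

lemma tendsto_expect_zc_mul_zc (hu : ∀ i, 0 < u i ∧ u i < 1) (i j : Fin k) :
    Tendsto (fun n : ℕ => 𝔼 a : Fin n, zc ⌊(n : ℝ) * u i⌋₊ a * zc ⌊(n : ℝ) * u j⌋₊ a) atTop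
      (𝓝 (bridge u i j)) := by
  have hi := tendsto_floor_div (hu i).1
  have hj := tendsto_floor_div (hu j).1
  refine ((hi.min hj).sub (hi.mul hj)).congr' ?_
  filter_upwards [eventually_ge_atTop 1] with n hn
  have : NeZero n := ⟨by omega⟩
  rw [expect_zc_mul_zc (floor_mul_le (hu i).2 n) (floor_mul_le (hu j).2 n)]

lemma bridge_self_pos (hu : ∀ i, 0 < u i ∧ u i < 1) (i : Fin k) : 0 < bridge u i i := by
  rw [bridge, min_self]
  nlinarith [hu i]

lemma limCov_self_pos (hu : ∀ i, 0 < u i ∧ u i < 1) (m : Fin k ⊕ Fin k) : 0 < limCov u m m := by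
  rcases m with i | i
  · exact pow_pos (bridge_self_pos hu i) 2
  · exact bridge_self_pos hu i

lemma expect_indepStat (hu : ∀ i, 0 < u i ∧ u i < 1) (m : Fin k ⊕ Fin k) :
    ∀ᶠ n in atTop, 𝔼 ω, indepStat Gr u n m ω = 0 := by
  filter_upwards [eventually_ge_atTop 1] with n hn
  have : NeZero n := ⟨by omega⟩
  rcases m with i | i
  · simp only [indepStat, ← expect_div]
    rw [expect_label fun g => edgeStat (Gr n) _ g, expect_edgeStat (floor_mul_le (hu i).2 n),
      zero_div]
  · simp only [indepStat, ← expect_div]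
    rw [expect_label fun g => degStat (Gr n) _ g, expect_degStat (floor_mul_le (hu i).2 n),
      zero_div]

lemma tendsto_expect_indepStat_mul (h1 : Cond1 ℓ Gr) (h2 : Cond2 ℓ Gr)
    (hu : ∀ i, 0 < u i ∧ u i < 1) (m m' : Fin k ⊕ Fin k) :
    Tendsto (fun n => 𝔼 ω, indepStat Gr u n m ω * indepStat Gr u n m' ω) atTop
      (𝓝 (limCov u m m')) := by
  obtain ⟨c, C, hc, hC, H⟩ := exists_bounds h1 h2
  have H' : ∀ᶠ n : ℕ in atTop, n ≠ 0 ∧ 0 < dnorm (Gr n) ∧ 0 < wnorm (Gr n) := by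
    filter_upwards [H] with n hn
    have hn0 : (0 : ℝ) < n := by exact_mod_cast (by omega : 0 < n)
    exact ⟨by omega, lt_of_lt_of_le (by positivity) hn.2.1,
      lt_of_lt_of_le (by positivity) hn.2.2.2.1⟩
  have hT := tendsto_expect_zc_mul_zc hu
  rcases m with i | i <;> rcases m' with j | j
  · refine ((hT i j).pow 2).congr' ?_
    filter_upwards [H'] with n ⟨hn, hd, hw⟩
    have : NeZero n := ⟨hn⟩
    simp only [indepStat, div_mul_div_comm, ← expect_div, Real.mul_self_sqrt hw.le]
    rw [expect_label fun g => edgeStat (Gr n) _ g * edgeStat (Gr n) _ g,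
      expect_edgeStat_mul (floor_mul_le (hu i).2 n), ← wnorm, mul_div_cancel_left₀ _ hw.ne']
  · refine tendsto_const_nhds.congr' ?_
    filter_upwards [H'] with n ⟨hn, hd, hw⟩
    have : NeZero n := ⟨hn⟩
    simp only [indepStat, div_mul_div_comm, ← expect_div]
    rw [expect_label fun g => edgeStat (Gr n) _ g * degStat (Gr n) _ g,
      expect_edgeStat_mul_degStat (floor_mul_le (hu i).2 n), zero_div, limCov]
  · refine tendsto_const_nhds.congr' ?_
    filter_upwards [H'] with n ⟨hn, hd, hw⟩
    have : NeZero n := ⟨hn⟩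
    simp only [indepStat, div_mul_div_comm, ← expect_div]
    simp_rw [mul_comm (degStat _ _ _)]
    rw [expect_label fun g => edgeStat (Gr n) _ g * degStat (Gr n) _ g,
      expect_edgeStat_mul_degStat (floor_mul_le (hu j).2 n), zero_div, limCov]
  · refine (hT i j).congr' ?_
    filter_upwards [H'] with n ⟨hn, hd, hw⟩
    have : NeZero n := ⟨hn⟩
    simp only [indepStat, div_mul_div_comm, ← expect_div, Real.mul_self_sqrt hd.le]
    rw [expect_label fun g => degStat (Gr n) _ g * degStat (Gr n) _ g,
      expect_degStat_mul (floor_mul_le (hu i).2 n), ← dnorm, mul_div_cancel_left₀ _ hd.ne']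

lemma tendsto_one_div_sqrt : Tendsto (fun n : ℕ => 1 / Real.sqrt n) atTop (𝓝 0) := by
  simp only [one_div]
  exact (Real.tendsto_sqrt_atTop.comp tendsto_natCast_atTop_atTop).inv_tendsto_atTop

lemma exists_centering (h1 : Cond1 ℓ Gr) (h2 : Cond2 ℓ Gr) (hu : ∀ i, 0 < u i ∧ u i < 1) :
    ∃ C : ℕ → Fin k ⊕ Fin k → ℝ, ∀ m, Tendsto
      (fun n => 𝔼 ω, (rawStat Gr u n m ω - C n m - indepStat Gr u n m ω) ^ 2) atTop (𝓝 0) := by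
  obtain ⟨c, C, hc, hC, H⟩ := exists_bounds h1 h2
  obtain ⟨N, hN⟩ := eventually_atTop.1 H
  set B : ℝ := max 4 ((88 * C + 320 * C ^ 2) / c)
  have hex : ∀ n m, ∃ C' : ℝ, N ≤ n →
      𝔼 ω, (rawStat Gr u n m ω - C' - indepStat Gr u n m ω) ^ 2 ≤ B * (1 / Real.sqrt n) := by
    intro n m
    by_cases hn : N ≤ n
    · obtain ⟨h4, hd, hd', hw, hm⟩ := hN n hn
      have : NeZero n := ⟨by omega⟩
      have hn0 : (0 : ℝ) < n := by exact_mod_cast (by omega : 0 < n)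
      have hs : 0 ≤ 1 / Real.sqrt n := by positivity
      rcases m with i | i
      · obtain ⟨C', hC'⟩ :=
          exists_expect_Routw_close (floor_mul_le (hu i).2 n) h4 hc hC hd' hw hm
        exact ⟨C', fun _ => hC'.trans (mul_le_mul_of_nonneg_right (le_max_right _ _) hs)⟩
      · obtain ⟨C', hC'⟩ := exists_expect_Routd_close (Gr := Gr n) (floor_mul_le (hu i).2 n)
          (lt_of_lt_of_le (by positivity) hd)
        exact ⟨C', fun _ => hC'.trans (mul_le_mul_of_nonneg_right (le_max_left _ _) hs)⟩
    · exact ⟨0, fun h => absurd h hn⟩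
  choose C' hC' using hex
  refine ⟨C', fun m => ?_⟩
  have hlim := tendsto_one_div_sqrt.const_mul B
  rw [mul_zero] at hlim
  refine tendsto_of_tendsto_of_tendsto_of_le_of_le' tendsto_const_nhds hlim
    (Eventually.of_forall fun n => expect_nonneg fun ω _ => sq_nonneg _) ?_
  filter_upwards [eventually_ge_atTop N] with n hn using hC' n m hn

end Limits

section Characteristic

open Finset Complex Filter Topology

variable {ℓ k : ℕ} {Gr : ∀ n : ℕ, Finset (Sym2 (Node n ℓ))} {u : Fin k → ℝ}

lemma tendsto_sum_card_mul_card (h3 : Cond3 ℓ Gr) :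
    Tendsto (fun n : ℕ => (1 / Real.sqrt n) ^ 3 * ∑ e ∈ Gout (Gr n),
      ((Ae (Gr n) e).card : ℝ) * (Be (Gr n) e).card) atTop (𝓝 0) := by
  refine h3.tendsto_div_nhds_zero.congr fun n => ?_
  have : (n : ℝ) ^ (1.5 : ℝ) = Real.sqrt n ^ 3 := by
    rw [Real.sqrt_eq_rpow, ← Real.rpow_natCast, ← Real.rpow_mul n.cast_nonneg]
    norm_num
  rw [this, one_div, inv_pow, div_eq_inv_mul]

lemma tendsto_inv_sqrt_cube_mul :
    Tendsto (fun n : ℕ => (1 / Real.sqrt n) ^ 3 * n) atTop (𝓝 0) := by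
  refine tendsto_one_div_sqrt.congr' ?_
  filter_upwards [eventually_ge_atTop 1] with n hn
  have hs : 0 < Real.sqrt n := Real.sqrt_pos.2 (by exact_mod_cast hn)
  have h := Real.mul_self_sqrt (n.cast_nonneg : (0 : ℝ) ≤ n)
  field_simp
  nlinarith

lemma sum_indepStat_eq (n : ℕ) (θ : Fin k ⊕ Fin k → ℝ) (ω : Coup n) :
    ∑ m, θ m * indepStat Gr u n m ω
      = stat (Gr n) (fun a b => ∑ i, θ (.inl i) / Real.sqrt (wnorm (Gr n))
          * (zc ⌊(n : ℝ) * u i⌋₊ a * zc ⌊(n : ℝ) * u i⌋₊ b))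
        (fun a => ∑ i, θ (.inr i) / Real.sqrt (dnorm (Gr n)) * zc ⌊(n : ℝ) * u i⌋₊ a)
        (label ω) := by
  simp only [Fintype.sum_sum_type, indepStat, stat, edgeStat, degStat, mul_sum]
  congr 1
  · rw [eq_div_iff two_ne_zero, sum_mul, sum_congr rfl fun a _ => sum_comm, sum_comm]
    refine sum_congr rfl fun i _ => ?_
    rw [show θ (.inl i) * ((∑ a, ∑ b, adj (Gr n) a b * (zc ⌊(n : ℝ) * u i⌋₊ (label ω a)
        * zc ⌊(n : ℝ) * u i⌋₊ (label ω b))) / 2 / Real.sqrt (wnorm (Gr n))) * 2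
      = θ (.inl i) / Real.sqrt (wnorm (Gr n)) * ∑ a, ∑ b, adj (Gr n) a b
        * (zc ⌊(n : ℝ) * u i⌋₊ (label ω a) * zc ⌊(n : ℝ) * u i⌋₊ (label ω b)) by ring]
    simp only [mul_sum]
    exact sum_congr rfl fun a _ => sum_congr rfl fun b _ => by ring
  · rw [sum_comm]
    refine sum_congr rfl fun i _ => ?_
    rw [← mul_div_assoc, mul_div_right_comm, mul_sum]
    exact sum_congr rfl fun a _ => by ring

lemma abs_sum_div_sqrt_mul_le {A B T : ℝ} (hA : 0 < A) (hB : A ≤ B) {x z : Fin k → ℝ}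
    (hx : ∑ i, |x i| ≤ T) (hz : ∀ i, |z i| ≤ 1) :
    |∑ i, x i / Real.sqrt B * z i| ≤ T / Real.sqrt A := by
  have hsA := Real.sqrt_pos.2 hA
  have hsB := Real.sqrt_pos.2 (hA.trans_le hB)
  have hT : 0 ≤ T := (sum_nonneg fun i _ => abs_nonneg _).trans hx
  calc |∑ i, x i / Real.sqrt B * z i| ≤ ∑ i, |x i / Real.sqrt B * z i| := abs_sum_le_sum_abs _ _
    _ ≤ ∑ i, |x i| / Real.sqrt B := sum_le_sum fun i _ => by
        rw [abs_mul, abs_div, abs_of_pos hsB]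
        exact mul_le_of_le_one_right (by positivity) (hz i)
    _ ≤ T / Real.sqrt B := by
        rw [← sum_div]
        gcongr
    _ ≤ T / Real.sqrt A := div_le_div_of_nonneg_left hT hsA (Real.sqrt_le_sqrt hB)

lemma norm_expect_exp_indepStat_sub_le (hu : ∀ i, 0 < u i ∧ u i < 1) {n : ℕ} [NeZero n]
    {c C : ℝ} (hc : 0 < c) (hd : c * n ≤ dnorm (Gr n)) (hw : c * n ≤ wnorm (Gr n))
    (hm : ((Gout (Gr n)).card : ℝ) ≤ C * n) (θ : Fin k ⊕ Fin k → ℝ) :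
    ‖(𝔼 ω, cexp ((∑ m, θ m * indepStat Gr u n m ω : ℝ) * I))
      - cexp (-((𝔼 ω, (∑ m, θ m * indepStat Gr u n m ω) ^ 2 : ℝ) : ℂ) / 2)‖
      ≤ 4 * ((∑ m, |θ m|) / Real.sqrt (c * n)) ^ 3 * ((2 * C) ^ 3 * n
        + 8 * (2 + 2 * C) * (3 + 2 * C) ^ 2 * ∑ e ∈ Gout (Gr n),
          ((Ae (Gr n) e).card : ℝ) * (Be (Gr n) e).card) := by
  have hn0 : (0 : ℝ) < n := by exact_mod_cast Nat.pos_of_ne_zero (NeZero.ne n)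
  have hcn : 0 < c * n := by positivity
  have hfl := fun i => floor_mul_le (hu i).2 n
  have hsum : ∑ m, |θ m| = ∑ i, |θ (.inl i)| + ∑ i, |θ (.inr i)| := Fintype.sum_sum_type _
  have hl : 0 ≤ ∑ i, |θ (.inl i)| := sum_nonneg fun i _ => abs_nonneg _
  have hr : 0 ≤ ∑ i, |θ (.inr i)| := sum_nonneg fun i _ => abs_nonneg _
  simp only [sum_indepStat_eq]
  rw [expect_label fun g => cexp ((stat (Gr n) _ _ g : ℝ) * I),
    expect_label fun g => stat (Gr n) _ _ g ^ 2]
  refine norm_expect_exp_stat_sub_le (by positivity) (fun a b => ?_) (fun a => ?_)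
    (fun a b hab => ?_) ?_ ?_
  · refine abs_sum_div_sqrt_mul_le hcn hw (by linarith) fun i => ?_
    rw [abs_mul]
    exact mul_le_one₀ (abs_zc_le (hfl i) a) (abs_nonneg _) (abs_zc_le (hfl i) b)
  · exact abs_sum_div_sqrt_mul_le hcn hd (by linarith) fun i => abs_zc_le (hfl i) a
  · rw [expect_sum_comm]
    refine sum_eq_zero fun i _ => ?_
    rw [← mul_expect, expect_zc_pair (hfl i), if_neg hab, mul_zero]
  · rw [expect_sum_comm]
    refine sum_eq_zero fun i _ => ?_
    rw [← mul_expect, expect_zc (hfl i), mul_zero]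
  · rw [div_le_iff₀ hn0]
    linarith

lemma tendsto_expect_exp_indepStat (h1 : Cond1 ℓ Gr) (h2 : Cond2 ℓ Gr) (h3 : Cond3 ℓ Gr)
    (hu : ∀ i, 0 < u i ∧ u i < 1) (θ : Fin k ⊕ Fin k → ℝ) :
    Tendsto (fun n => (𝔼 ω, cexp ((∑ m, θ m * indepStat Gr u n m ω : ℝ) * I))
      - cexp (-((𝔼 ω, (∑ m, θ m * indepStat Gr u n m ω) ^ 2 : ℝ) : ℂ) / 2)) atTop (𝓝 0) := by
  obtain ⟨c, C, hc, hC, H⟩ := exists_bounds h1 h2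
  set T : ℝ := ∑ m, |θ m|
  have hlim := ((tendsto_inv_sqrt_cube_mul.const_mul ((2 * C) ^ 3)).add
    ((tendsto_sum_card_mul_card h3).const_mul (8 * (2 + 2 * C) * (3 + 2 * C) ^ 2))).const_mul
      (4 * (T / Real.sqrt c) ^ 3)
  simp only [mul_zero, add_zero] at hlim
  refine squeeze_zero_norm' ?_ hlim
  filter_upwards [H] with n ⟨hn, hd, _, hw, hm⟩
  have : NeZero n := ⟨by omega⟩
  refine (norm_expect_exp_indepStat_sub_le hu hc hd hw hm θ).trans (le_of_eq ?_)
  rw [Real.sqrt_mul hc.le, ← div_div, div_pow _ (Real.sqrt n), div_pow 1, one_pow]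
  ring

end Characteristic

section Levy

open Finset Filter Topology MeasureTheory
open scoped RealInnerProductSpace

/-- The law of a random variable on a finite uniform probability space. -/
def unifLaw {Ω E : Type*} [Fintype Ω] [MeasurableSpace E] (Z : Ω → E) : Measure E :=
  (Fintype.card Ω : ENNReal)⁻¹ • ∑ ω, Measure.dirac (Z ω)

instance {Ω E : Type*} [Fintype Ω] [Nonempty Ω] [MeasurableSpace E] (Z : Ω → E) :
    IsProbabilityMeasure (unifLaw Z) where
  measure_univ := by
    simp [unifLaw, ENNReal.inv_mul_cancel]

lemma integral_unifLaw {Ω E F : Type*} [Fintype Ω] [MeasurableSpace E]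
    [MeasurableSingletonClass E] [NormedAddCommGroup F] [NormedSpace ℝ F] [CompleteSpace F]
    [Module ℚ≥0 F] (Z : Ω → E) (f : E → F) : ∫ x, f x ∂(unifLaw Z) = 𝔼 ω, f (Z ω) := by
  rw [unifLaw, integral_smul_measure, integral_finsetSum_measure]
  · simp only [integral_dirac, ENNReal.toReal_inv, ENNReal.toReal_natCast, Finset.expect, card_univ]
    rw [← NNRat.cast_smul_eq_nnqsmul ℝ]
    simp
  · exact fun ω _ => integrable_dirac (by simp)

variable {Ω : ℕ → Type*} [∀ n, Fintype (Ω n)] [∀ n, Nonempty (Ω n)] {M : Type*} [Fintype M]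

lemma tendsto_expect_of_tendsto_charFun {Z : ∀ n, Ω n → EuclideanSpace ℝ M}
    {ν : Measure (EuclideanSpace ℝ M)} [IsProbabilityMeasure ν]
    (h : ∀ θ, Tendsto (fun n => 𝔼 ω, Complex.exp ((⟪Z n ω, θ⟫ : ℝ) * Complex.I)) atTop
      (𝓝 (charFun ν θ))) (f : BoundedContinuousFunction (EuclideanSpace ℝ M) ℝ) :
    Tendsto (fun n => 𝔼 ω, f (Z n ω)) atTop (𝓝 (∫ x, f x ∂ν)) := by
  let P : ℕ → ProbabilityMeasure (EuclideanSpace ℝ M) := fun n => ⟨unifLaw (Z n), inferInstance⟩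
  let Q : ProbabilityMeasure (EuclideanSpace ℝ M) := ⟨ν, inferInstance⟩
  have hl : Tendsto P atTop (𝓝 Q) := by
    refine ProbabilityMeasure.tendsto_of_tendsto_charFun fun θ => ?_
    refine (h θ).congr fun n => ?_
    rw [charFun_apply]
    exact (integral_unifLaw (Z n) fun x => Complex.exp ((⟪x, θ⟫ : ℝ) * Complex.I)).symm
  refine (ProbabilityMeasure.tendsto_iff_forall_integral_tendsto.1 hl f).congr fun n => ?_
  exact integral_unifLaw (Z n) f

end Levy

section Standardized

open Finset Complex Filter Topology

variable {ℓ k : ℕ} (Gr : ∀ n : ℕ, Finset (Sym2 (Node n ℓ))) (u : Fin k → ℝ)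

/-- The standardized statistics. -/
def zstat (n : ℕ) : Fin k ⊕ Fin k → Equiv.Perm (Fin n) → ℝ
  | .inl i => Zoutw (Gr n) ⌊(n : ℝ) * u i⌋₊
  | .inr i => Zoutd (Gr n) ⌊(n : ℝ) * u i⌋₊

/-- The limiting correlation matrix of the standardized statistics. -/
def limCorr : Matrix (Fin k ⊕ Fin k) (Fin k ⊕ Fin k) ℝ := fun m m' =>
  limCov u m m' / (Real.sqrt (limCov u m m) * Real.sqrt (limCov u m' m'))

variable {Gr u}

lemma stdz_coup {n : ℕ} [NeZero n] (F : Equiv.Perm (Fin n) → ℝ) (ω : Coup n) :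
    stdz (fun ω : Coup n => F ω.2) ω = (F ω.2 - pexp F) / Real.sqrt (pvar F) := by
  rw [stdz, expect_coup_snd F, expect_coup_snd fun τ => (F τ - 𝔼 τ, F τ) ^ 2, pvar, pcov]
  simp only [pexp_eq_expect, sq]

lemma stdz_rawStat (h1 : Cond1 ℓ Gr) (h2 : Cond2 ℓ Gr) :
    ∀ᶠ n in atTop, n ≠ 0 ∧ ∀ m ω, stdz (rawStat Gr u n m) ω = zstat Gr u n m ω.2 := by
  obtain ⟨c, C, hc, hC, H⟩ := exists_bounds h1 h2
  filter_upwards [H] with n ⟨hn, hd, _, hw, _⟩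
  have : NeZero n := ⟨by omega⟩
  have hn0 : (0 : ℝ) < n := by exact_mod_cast (by omega : 0 < n)
  refine ⟨by omega, fun m ω => ?_⟩
  rcases m with i | i
  · have := stdz_div (fun ω : Coup n => Routw (Gr n) ⌊(n : ℝ) * u i⌋₊ ω.2)
      (Real.sqrt_pos.2 (lt_of_lt_of_le (mul_pos hc hn0) hw))
    exact (congrFun this ω).trans (stdz_coup (Routw (Gr n) ⌊(n : ℝ) * u i⌋₊) ω)
  · have := stdz_div (fun ω : Coup n => Routd (Gr n) ⌊(n : ℝ) * u i⌋₊ ω.2)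
      (Real.sqrt_pos.2 (lt_of_lt_of_le (mul_pos hc hn0) hd))
    exact (congrFun this ω).trans (stdz_coup (Routd (Gr n) ⌊(n : ℝ) * u i⌋₊) ω)

lemma tendsto_expect_zstat_mul (h1 : Cond1 ℓ Gr) (h2 : Cond2 ℓ Gr)
    (hu : ∀ i, 0 < u i ∧ u i < 1) (m m' : Fin k ⊕ Fin k) :
    Tendsto (fun n => 𝔼 τ, zstat Gr u n m τ * zstat Gr u n m' τ) atTop
      (𝓝 (limCorr u m m')) := by
  obtain ⟨C, hC⟩ := exists_centering h1 h2 hu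
  refine (tendsto_expect_stdz_mul hC (expect_indepStat hu)
    (tendsto_expect_indepStat_mul h1 h2 hu) (limCov_self_pos hu) m m').congr' ?_
  filter_upwards [stdz_rawStat (u := u) h1 h2] with n ⟨hn, h⟩
  have : NeZero n := ⟨hn⟩
  simp only [h]
  exact expect_coup_snd fun τ => zstat Gr u n m τ * zstat Gr u n m' τ

lemma tendsto_expect_exp_zstat (h1 : Cond1 ℓ Gr) (h2 : Cond2 ℓ Gr) (h3 : Cond3 ℓ Gr)
    (hu : ∀ i, 0 < u i ∧ u i < 1) (θ : Fin k ⊕ Fin k → ℝ) :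
    Tendsto (fun n => 𝔼 τ, cexp ((∑ m, θ m * zstat Gr u n m τ : ℝ) * I)) atTop
      (𝓝 (cexp (-((∑ m, ∑ m', θ m * θ m' * limCorr u m m' : ℝ) : ℂ) / 2))) := by
  obtain ⟨C, hC⟩ := exists_centering h1 h2 hu
  refine (tendsto_expect_exp_stdz hC (expect_indepStat hu)
    (tendsto_expect_indepStat_mul h1 h2 hu) (limCov_self_pos hu)
    (tendsto_expect_exp_indepStat h1 h2 h3 hu) θ).congr' ?_
  filter_upwards [stdz_rawStat (u := u) h1 h2] with n ⟨hn, h⟩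
  have : NeZero n := ⟨hn⟩
  simp only [h]
  exact expect_coup_snd fun τ => cexp ((∑ m, θ m * zstat Gr u n m τ : ℝ) * I)

lemma pexp_zstat (n : ℕ) (m : Fin k ⊕ Fin k) : pexp (zstat Gr u n m) = 0 := by
  have h : ∀ (f : Equiv.Perm (Fin n) → ℝ) (s : ℝ), pexp (fun σ => (f σ - pexp f) / s) = 0 :=
    fun f s => by
      simp only [pexp_eq_expect, ← expect_div, expect_sub_distrib, Fintype.expect_const, sub_self,
        zero_div]
  rcases m with i | i
  · exact h _ _
  · exact h _ _

lemma tendsto_pcov_zstat (h1 : Cond1 ℓ Gr) (h2 : Cond2 ℓ Gr)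
    (hu : ∀ i, 0 < u i ∧ u i < 1) (m m' : Fin k ⊕ Fin k) :
    Tendsto (fun n => pcov (zstat Gr u n m) (zstat Gr u n m')) atTop (𝓝 (limCorr u m m')) := by
  refine (tendsto_expect_zstat_mul h1 h2 hu m m').congr fun n => ?_
  simp only [pcov, pexp_zstat, sub_zero]
  rw [pexp_eq_expect]

lemma posSemidef_limCorr (h1 : Cond1 ℓ Gr) (h2 : Cond2 ℓ Gr) (hu : ∀ i, 0 < u i ∧ u i < 1) :
    (limCorr u).PosSemidef := by
  have hT := tendsto_expect_zstat_mul h1 h2 hu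
  refine Matrix.posSemidef_iff_dotProduct_mulVec.2 ⟨?_, fun x => ?_⟩
  · ext m m'
    rw [Matrix.conjTranspose_apply, star_trivial]
    refine tendsto_nhds_unique (hT m' m) ((hT m m').congr fun n => ?_)
    simp only [mul_comm]
  · have hl : Tendsto (fun n => ∑ m, ∑ m', x m * (𝔼 τ, zstat Gr u n m τ * zstat Gr u n m' τ)
        * x m') atTop (𝓝 (∑ m, ∑ m', x m * limCorr u m m' * x m')) :=
      tendsto_finsetSum _ fun m _ => tendsto_finsetSum _ fun m' _ =>
        ((hT m m').const_mul (x m)).mul_const (x m')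
    have e : star x ⬝ᵥ Matrix.mulVec (limCorr u) x = ∑ m, ∑ m', x m * limCorr u m m' * x m' := by
      simp only [dotProduct, Matrix.mulVec, mul_sum, Pi.star_apply, star_trivial, mul_assoc]
    rw [e]
    refine ge_of_tendsto' hl fun n => ?_
    have e' : ∑ m, ∑ m', x m * (𝔼 τ, zstat Gr u n m τ * zstat Gr u n m' τ) * x m'
        = 𝔼 τ, (∑ m, x m * zstat Gr u n m τ) ^ 2 := by
      simp only [mul_expect, expect_mul, ← expect_sum_comm]
      refine expect_congr rfl fun τ _ => ?_
      rw [sq, sum_mul_sum]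
      exact sum_congr rfl fun m _ => sum_congr rfl fun m' _ => by ring
    rw [e']
    exact expect_nonneg fun τ _ => sq_nonneg _

end Standardized

section Limit

open Finset Filter Topology MeasureTheory ProbabilityTheory
open scoped RealInnerProductSpace

variable {k : ℕ}

/-- The two blocks of coordinates of a vector. -/
def blocks (k : ℕ) : EuclideanSpace ℝ (Fin k ⊕ Fin k) →L[ℝ] (Fin k → ℝ) × (Fin k → ℝ) :=
  (ContinuousLinearMap.pi fun i => EuclideanSpace.proj (.inl i)).prod
    (ContinuousLinearMap.pi fun i => EuclideanSpace.proj (.inr i))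

/-- The limiting Gaussian law. -/
def limLaw (u : Fin k → ℝ) : Measure ((Fin k → ℝ) × (Fin k → ℝ)) :=
  (multivariateGaussian 0 (limCorr u)).map (blocks k)

variable {u : Fin k → ℝ}

lemma isCenteredGaussian_of_integral_eq_zero {E : Type*} [NormedAddCommGroup E] [NormedSpace ℝ E]
    [MeasurableSpace E] {μ : Measure E} [IsGaussian μ] (h : ∀ L : E →L[ℝ] ℝ, ∫ x, L x ∂μ = 0) :
    IsCenteredGaussian μ := fun L =>
  ⟨_, by rw [IsGaussian.map_eq_gaussianReal (μ := μ) L, h L]⟩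

lemma integral_multivariateGaussian_zero {ι F : Type*} [Fintype ι] [DecidableEq ι]
    [NormedAddCommGroup F] [NormedSpace ℝ F] [CompleteSpace F]
    (S : Matrix ι ι ℝ) (L : EuclideanSpace ℝ ι →L[ℝ] F) :
    ∫ x, L x ∂(multivariateGaussian 0 S) = 0 := by
  rw [ContinuousLinearMap.integral_comp_comm L IsGaussian.integrable_fun_id,
    integral_id_multivariateGaussian, map_zero]

instance : IsGaussian (limLaw u) := isGaussian_map (blocks k)

lemma isCenteredGaussian_limLaw : IsCenteredGaussian (limLaw u) :=
  isCenteredGaussian_of_integral_eq_zero fun L => by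
    rw [limLaw, integral_map (by fun_prop) (by fun_prop)]
    exact integral_multivariateGaussian_zero _ (L.comp (blocks k))

lemma integral_mul_multivariateGaussian (hS : (limCorr u).PosSemidef) (m m' : Fin k ⊕ Fin k) :
    ∫ x, x m * x m' ∂(multivariateGaussian 0 (limCorr u)) = limCorr u m m' := by
  have h0 : ∀ m, ∫ x, x m ∂(multivariateGaussian 0 (limCorr u)) = 0 := fun m =>
    integral_multivariateGaussian_zero _ (EuclideanSpace.proj m)
  have h := covariance_eval_multivariateGaussian (μ := 0) hS m m'
  simpa only [covariance, h0, sub_zero] using h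

lemma integral_limLaw {F : (Fin k → ℝ) × (Fin k → ℝ) → ℝ} (hF : Continuous F) :
    ∫ x, F x ∂(limLaw u) = ∫ x, F (blocks k x) ∂(multivariateGaussian 0 (limCorr u)) :=
  integral_map (by fun_prop) hF.aestronglyMeasurable

lemma limLaw_eq_prod (hS : (limCorr u).PosSemidef) :
    limLaw u = (limLaw u).fst.prod (limLaw u).snd := by
  have hG : HasGaussianLaw (fun x : EuclideanSpace ℝ (Fin k ⊕ Fin k) =>
      ((fun i => x (.inl i), fun i => x (.inr i)) : (Fin k → ℝ) × (Fin k → ℝ)))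
      (multivariateGaussian 0 (limCorr u)) := ⟨inferInstanceAs (IsGaussian (limLaw u))⟩
  have hI := hG.indepFun_of_covariance_eval
    (X := fun i (x : EuclideanSpace ℝ (Fin k ⊕ Fin k)) => x (.inl i))
    (Y := fun i (x : EuclideanSpace ℝ (Fin k ⊕ Fin k)) => x (.inr i)) fun i j => by
      rw [covariance_eval_multivariateGaussian hS]
      exact zero_div _
  rw [indepFun_iff_map_prod_eq_prod_map_map (by fun_prop) (by fun_prop)] at hI
  have hl : limLaw u = _ := hI
  have : IsProbabilityMeasure (Measure.map (fun (x : EuclideanSpace ℝ (Fin k ⊕ Fin k)) i =>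
      x (.inl i)) (multivariateGaussian 0 (limCorr u))) :=
    Measure.isProbabilityMeasure_map (by fun_prop)
  have : IsProbabilityMeasure (Measure.map (fun (x : EuclideanSpace ℝ (Fin k ⊕ Fin k)) i =>
      x (.inr i)) (multivariateGaussian 0 (limCorr u))) :=
    Measure.isProbabilityMeasure_map (by fun_prop)
  rw [hl, Measure.fst_prod, Measure.snd_prod]

lemma charFun_multivariateGaussian_limCorr (hS : (limCorr u).PosSemidef)
    (θ : EuclideanSpace ℝ (Fin k ⊕ Fin k)) :
    charFun (multivariateGaussian 0 (limCorr u)) θ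
      = Complex.exp (-((∑ m, ∑ m', θ m * θ m' * limCorr u m m' : ℝ) : ℂ) / 2) := by
  rw [charFun_multivariateGaussian hS, inner_zero_right]
  congr 1
  have : θ.ofLp ⬝ᵥ Matrix.mulVec (limCorr u) θ.ofLp = ∑ m, ∑ m', θ m * θ m' * limCorr u m m' := by
    simp only [dotProduct, Matrix.mulVec, mul_sum]
    exact sum_congr rfl fun m _ => sum_congr rfl fun m' _ => by ring
  rw [this]
  push_cast
  ring

lemma tendsto_expect_limLaw {ℓ : ℕ} {Gr : ∀ n : ℕ, Finset (Sym2 (Node n ℓ))}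
    (h1 : Cond1 ℓ Gr) (h2 : Cond2 ℓ Gr) (h3 : Cond3 ℓ Gr) (hu : ∀ i, 0 < u i ∧ u i < 1)
    (f : BoundedContinuousFunction ((Fin k → ℝ) × (Fin k → ℝ)) ℝ) :
    Tendsto (fun n => 𝔼 τ, f (fun i => zstat Gr u n (.inl i) τ, fun i => zstat Gr u n (.inr i) τ))
      atTop (𝓝 (∫ x, f x ∂(limLaw u))) := by
  have hS := posSemidef_limCorr h1 h2 hu
  rw [integral_limLaw f.continuous]
  refine tendsto_expect_of_tendsto_charFun (Ω := fun n => Equiv.Perm (Fin n))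
    (Z := fun n τ => WithLp.toLp 2 fun m => zstat Gr u n m τ) (fun θ => ?_)
    (f.compContinuous ⟨blocks k, (blocks k).continuous⟩)
  rw [charFun_multivariateGaussian_limCorr hS]
  refine (tendsto_expect_exp_zstat h1 h2 h3 hu θ).congr fun n => expect_congr rfl fun τ _ => ?_
  simp [PiLp.inner_apply]

end Limit

/-- Joint finite-dimensional convergence of `(Z_out,w, Z_out,d)` to a pair of
independent centered Gaussian processes, with covariance matrix the limit of the permutation-null
covariance matrices. -/
theorem fdd_Zoutw_Zoutd (ℓ : ℕ) (Gr : ∀ n : ℕ, Finset (Sym2 (Node n ℓ)))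
    (hG : ∀ n, ∀ e ∈ Gr n, ¬ e.IsDiag)
    (h1 : Cond1 ℓ Gr) (h2 : Cond2 ℓ Gr) (h3 : Cond3 ℓ Gr)
    (k : ℕ) (u : Fin k → ℝ) (hu : ∀ i, 0 < u i ∧ u i < 1) (hmono : StrictMono u) :
    ∃ μ : MeasureTheory.Measure ((Fin k → ℝ) × (Fin k → ℝ)),
      MeasureTheory.IsProbabilityMeasure μ ∧
      IsCenteredGaussian μ ∧
      μ = μ.fst.prod μ.snd ∧
      (∀ f : BoundedContinuousFunction ((Fin k → ℝ) × (Fin k → ℝ)) ℝ,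
        Filter.Tendsto
          (fun n : ℕ => pexp (fun σ =>
            f (fun i => Zoutw (Gr n) ⌊(n : ℝ) * u i⌋₊ σ,
               fun i => Zoutd (Gr n) ⌊(n : ℝ) * u i⌋₊ σ)))
          Filter.atTop (nhds (∫ x, f x ∂μ))) ∧
      (∀ i j : Fin k,
        Filter.Tendsto
          (fun n : ℕ => pcov (Zoutw (Gr n) ⌊(n : ℝ) * u i⌋₊) (Zoutw (Gr n) ⌊(n : ℝ) * u j⌋₊))
          Filter.atTop (nhds (∫ x, x.1 i * x.1 j ∂μ)) ∧
        Filter.Tendsto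
          (fun n : ℕ => pcov (Zoutw (Gr n) ⌊(n : ℝ) * u i⌋₊) (Zoutd (Gr n) ⌊(n : ℝ) * u j⌋₊))
          Filter.atTop (nhds (∫ x, x.1 i * x.2 j ∂μ)) ∧
        Filter.Tendsto
          (fun n : ℕ => pcov (Zoutd (Gr n) ⌊(n : ℝ) * u i⌋₊) (Zoutd (Gr n) ⌊(n : ℝ) * u j⌋₊))
          Filter.atTop (nhds (∫ x, x.2 i * x.2 j ∂μ))) := by
  have hS := posSemidef_limCorr h1 h2 hu
  have hcov := tendsto_pcov_zstat h1 h2 hu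
  refine ⟨limLaw u, inferInstance, isCenteredGaussian_limLaw, limLaw_eq_prod hS, fun f => ?_,
    fun i j => ⟨?_, ?_, ?_⟩⟩
  · simp only [pexp_eq_expect]
    exact tendsto_expect_limLaw h1 h2 h3 hu f
  · rw [integral_limLaw (by fun_prop)]
    exact (integral_mul_multivariateGaussian hS (.inl i) (.inl j)).symm ▸ hcov (.inl i) (.inl j)
  · rw [integral_limLaw (by fun_prop)]
    exact (integral_mul_multivariateGaussian hS (.inl i) (.inr j)).symm ▸ hcov (.inl i) (.inr j)
  · rw [integral_limLaw (by fun_prop)]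
    exact (integral_mul_multivariateGaussian hS (.inr i) (.inr j)).symm ▸ hcov (.inr i) (.inr j)

end CPD
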